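/- For every N ≥ 1 there exists a bilinear operator R²_N: C^∞(T^d;ℝ) × C^∞₀(T^d;ℝ) → C^∞₀(T^d;Sym(d)) such that div div R²_N(f,g) = fg − ⨍_{T^d} fg, and for all j ∈ ℕ∪{0} and all p, r, s ∈ [1,∞] with 1/p = 1/s + 1/r there is a constant C (depending on j, d, p, s, r, N) such that for every λ ∈ ℕ: |∇^j R²_N(f, g(λ·))|_{L^p(T^d)} ≤ C λ^j |g|_{W^{j,s}(T^d)} (λ^{−2}|f|_{L^r(T^d)} + λ^{−N}|∇^N f|_{L^r(T^d)} + λ^{−(2N+j)}|∇^{2N+j} f|_{L^r(T^d)}). -/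

import Mathlib

open MeasureTheory ENNReal NNReal

noncomputable section

namespace NonNewtonian

abbrev Pt (d : ℕ) := Fin d → ℝ
abbrev Mat (d : ℕ) := Fin d → Fin d → ℝ

/-- The fundamental domain `[0,1]^d` of the torus `T^d = ℝ^d/ℤ^d`. -/
def box (d : ℕ) : Set (Pt d) := Set.Icc 0 1

/-- Lebesgue measure restricted to the fundamental domain. -/
def μbox (d : ℕ) : Measure (Pt d) := volume.restrict (box d)

/-- `ℤ^d`-periodicity (functions on the torus). -/
def ZPer {d : ℕ} {α : Type*} (f : Pt d → α) : Prop :=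
  ∀ (x : Pt d) (m : Fin d → ℤ), f (x + fun i => (m i : ℝ)) = f x

/-- Double divergence `div div R = ∑_{i,j} ∂_i ∂_j R_{ij}` of a matrix field. -/
def divDivMat {d : ℕ} (R : Pt d → Mat d) (x : Pt d) : ℝ :=
  ∑ i, ∑ j, fderiv ℝ (fun y => fderiv ℝ (fun z => R z i j) y (Pi.single j 1)) x (Pi.single i 1)

/-- Smooth, `ℤ^d`-periodic scalar functions on the torus. -/
def AdmissibleScal (d : ℕ) (f : Pt d → ℝ) : Prop :=
  ContDiff ℝ ((⊤:ℕ∞)) f ∧ ZPer f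

/-- Smooth, `ℤ^d`-periodic, zero-mean scalar functions on the torus. -/
def AdmissibleScal₀ (d : ℕ) (g : Pt d → ℝ) : Prop :=
  AdmissibleScal d g ∧ (∫ x in box d, g x) = 0

/-- The `W^{j,s}` norm on the torus. -/
def WNorm (d : ℕ) (j : ℕ) (s : ℝ≥0∞) (g : Pt d → ℝ) : ℝ≥0∞ :=
  ∑ m ∈ Finset.range (j + 1), eLpNorm (fun x => iteratedFDeriv ℝ m g x) s (μbox d)

/-- The covering map from `ℝ^d` to the torus. -/
def torusMk (d : ℕ) (x : Pt d) : UnitAddTorus (Fin d) := fun i => (x i : UnitAddCircle)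

lemma measurePreserving_torusMk (d : ℕ) : MeasurePreserving (torusMk d) (μbox d) volume := by
  have h := measurePreserving_pi
    (fun _ : Fin d => (volume : Measure ℝ).restrict (Set.Ioc 0 (0 + 1)))
    (fun _ => (volume : Measure UnitAddCircle)) (fun _ => UnitAddCircle.measurePreserving_mk 0)
  have e : μbox d =
      Measure.pi (fun _ : Fin d => (volume : Measure ℝ).restrict (Set.Ioc 0 (0 + 1))) := by
    rw [μbox, box, ← Set.pi_univ_Icc, volume_pi, Measure.restrict_pi_pi]
    congr 1
    funext i
    simp only [Pi.zero_apply, Pi.one_apply, zero_add]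
    exact (restrict_Ioc_eq_restrict_Icc).symm
  rw [e]
  exact h

instance isProbabilityMeasure_μbox (d : ℕ) : IsProbabilityMeasure (μbox d) :=
  ⟨by rw [μbox, Measure.restrict_apply_univ, box, Real.volume_Icc_pi]; simp⟩

lemma ZPer.exists_torus_lift {d : ℕ} {h : Pt d → ℝ} (hp : ZPer h) (hm : Measurable h) :
    ∃ H : UnitAddTorus (Fin d) → ℝ, Measurable H ∧ ∀ x, H (torusMk d x) = h x := by
  refine ⟨fun y => h fun i => (AddCircle.measurableEquivIco 1 0 (y i) : ℝ), ?_, fun x => ?_⟩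
  · exact hm.comp (measurable_pi_lambda _ fun i => measurable_subtype_coe.comp
      ((AddCircle.measurableEquivIco 1 0).measurable.comp (measurable_pi_apply i)))
  · have key : ∀ t : ℝ, ∃ m : ℤ,
        (AddCircle.measurableEquivIco 1 0 (t : UnitAddCircle) : ℝ) = t + m := by
      intro t
      refine ⟨-⌊t⌋, (AddCircle.coe_equivIco_mk_apply 1 t).trans ?_⟩
      simp [Int.fract, sub_eq_add_neg]
    choose m hm using fun i => key (x i)
    have : (fun i => (AddCircle.measurableEquivIco 1 0 (torusMk d x i) : ℝ))
        = x + fun i => ((m i : ℤ) : ℝ) := funext fun i => hm i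
    simp only [this]
    exact hp x m

lemma ZPer.measurePreserving_comp {d : ℕ} {h : Pt d → ℝ} (hp : ZPer h) (hm : Measurable h)
    {φ : Pt d → Pt d} {Φ : UnitAddTorus (Fin d) → UnitAddTorus (Fin d)}
    (hΦ : MeasurePreserving Φ volume volume) (hφ : ∀ x, torusMk d (φ x) = Φ (torusMk d x)) :
    (∀ s, eLpNorm (fun x => h (φ x)) s (μbox d) = eLpNorm h s (μbox d)) ∧
    (∫ x, h (φ x) ∂μbox d) = ∫ x, h x ∂μbox d := by
  obtain ⟨H, hH, hHh⟩ := hp.exists_torus_lift hm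
  have e1 : h = H ∘ torusMk d := funext fun x => (hHh x).symm
  have e2 : (fun x => h (φ x)) = H ∘ (Φ ∘ torusMk d) :=
    funext fun x => by simp [← hφ, hHh]
  have h1 := measurePreserving_torusMk d
  have h2 := hΦ.comp h1
  constructor
  · intro s
    rw [e2, e1, eLpNorm_comp_measurePreserving hH.aestronglyMeasurable h2,
      eLpNorm_comp_measurePreserving hH.aestronglyMeasurable h1]
  · rw [e2, e1]
    have i1 := integral_map h1.measurable.aemeasurable
      (hH.aestronglyMeasurable (μ := (μbox d).map (torusMk d)))
    have i2 := integral_map h2.measurable.aemeasurable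
      (hH.aestronglyMeasurable (μ := (μbox d).map (Φ ∘ torusMk d)))
    rw [h1.map_eq] at i1
    rw [h2.map_eq] at i2
    exact i2.symm.trans i1

lemma ZPer.comp_add {d : ℕ} {h : Pt d → ℝ} (hp : ZPer h) (hm : Measurable h) (v : Pt d) :
    (∀ s, eLpNorm (fun x => h (x + v)) s (μbox d) = eLpNorm h s (μbox d)) ∧
    (∫ x, h (x + v) ∂μbox d) = ∫ x, h x ∂μbox d :=
  hp.measurePreserving_comp hm (φ := fun x => x + v)
    (measurePreserving_pi _ _ fun i => measurePreserving_add_right volume (v i : UnitAddCircle))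
    (fun x => by funext i; simp [torusMk])

lemma ZPer.comp_scale {d : ℕ} {h : Pt d → ℝ} (hp : ZPer h) (hm : Measurable h) {n : ℕ}
    (hn : n ≠ 0) (s : ℝ≥0∞) :
    eLpNorm (fun x => h (fun i => (n : ℝ) * x i)) s (μbox d) = eLpNorm h s (μbox d) :=
  (hp.measurePreserving_comp hm (φ := fun x i => (n : ℝ) * x i)
    (measurePreserving_pi _ _ fun i => Measure.measurePreserving_zsmul
      (volume : Measure UnitAddCircle) (n := (n : ℤ)) (by exact_mod_cast hn))
    (fun x => by
      funext i
      simp only [torusMk, ← nsmul_eq_mul]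
      rw [AddCircle.coe_nsmul, natCast_zsmul])).1 s

/-- The weighted average `∫₀¹ (a t + b) h(x + t v) dt` of `h` along the segment from `x` to
`x + v`. -/
def segInt {d : ℕ} {E : Type} [NormedAddCommGroup E] [NormedSpace ℝ E] (v : Pt d) (a b : ℝ)
    (h : Pt d → E) (x : Pt d) : E :=
  ∫ t in (0 : ℝ)..1, (a * t + b) • h (x + t • v)

section segInt

variable {d : ℕ} {E : Type} [NormedAddCommGroup E] [NormedSpace ℝ E]

lemma continuous_segInt_integrand {h : Pt d → E} (hh : Continuous h) (v : Pt d) (a b : ℝ) :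
    Continuous (fun q : Pt d × ℝ => (a * q.2 + b) • h (q.1 + q.2 • v)) := by fun_prop

lemma continuous_segInt {h : Pt d → E} (hh : Continuous h) (v : Pt d) (a b : ℝ) :
    Continuous (segInt v a b h) :=
  intervalIntegral.continuous_parametric_intervalIntegral_of_continuous'
    (f := fun x t => (a * t + b) • h (x + t • v)) (continuous_segInt_integrand hh v a b) 0 1

lemma hasFDerivAt_segInt {h : Pt d → E} (hh : ContDiff ℝ 1 h) (v : Pt d) (a b : ℝ) (x : Pt d) :
    HasFDerivAt (segInt v a b h) (segInt v a b (fderiv ℝ h) x) x := by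
  have hc : Continuous (fderiv ℝ h) := hh.continuous_fderiv one_ne_zero
  have hF := continuous_segInt_integrand hh.continuous v a b
  have hF' := continuous_segInt_integrand hc v a b
  obtain ⟨C, hC⟩ := ((isCompact_closedBall x 1).prod (isCompact_Icc (a := (0 : ℝ)) (b := 1))
    ).exists_bound_of_continuousOn
    hF'.continuousOn
  refine intervalIntegral.hasFDerivAt_integral_of_dominated_of_fderiv_le (𝕜 := ℝ)
    (F := fun x t => (a * t + b) • h (x + t • v))
    (F' := fun x t => (a * t + b) • fderiv ℝ h (x + t • v)) (bound := fun _ => C)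
    (Metric.closedBall_mem_nhds x one_pos) ?_ ?_ ?_ ?_ ?_ ?_
  · exact Filter.Eventually.of_forall fun y =>
      (hF.comp (Continuous.prodMk_right y)).aestronglyMeasurable
  · exact (hF.comp (Continuous.prodMk_right x)).intervalIntegrable _ _
  · exact (hF'.comp (Continuous.prodMk_right x)).aestronglyMeasurable
  · refine Filter.Eventually.of_forall fun t ht y hy => hC (y, t) ⟨hy, ?_⟩
    rw [Set.uIoc_of_le zero_le_one] at ht
    exact Set.Ioc_subset_Icc_self ht
  · exact intervalIntegrable_const
  · refine Filter.Eventually.of_forall fun t _ y _ => ?_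
    have h1 : HasFDerivAt h (fderiv ℝ h (y + t • v)) (y + t • v) :=
      (hh.differentiable one_ne_zero _).hasFDerivAt
    exact ((hasFDerivAt_comp_add_right (t • v)).2 h1).const_smul (a * t + b)

lemma contDiff_segInt_nat (n : ℕ) {h : Pt d → E} (hh : ContDiff ℝ n h) (v : Pt d) (a b : ℝ) :
    ContDiff ℝ n (segInt v a b h) := by
  induction n generalizing E with
  | zero => exact contDiff_zero.2 (continuous_segInt (contDiff_zero.1 hh) v a b)
  | succ n ih =>
    have h1 : ContDiff ℝ 1 h := hh.of_le (by exact_mod_cast Nat.le_add_left 1 n)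
    have hd := hasFDerivAt_segInt h1 v a b
    have e : fderiv ℝ (segInt v a b h) = segInt v a b (fderiv ℝ h) :=
      funext fun x => (hd x).fderiv
    push_cast at hh ⊢
    rw [contDiff_succ_iff_fderiv] at hh ⊢
    refine ⟨fun x => (hd x).differentiableAt, by simp, ?_⟩
    rw [e]
    exact ih hh.2.2

lemma contDiff_segInt {h : Pt d → E} (hh : ContDiff ℝ ((⊤ : ℕ∞)) h) (v : Pt d) (a b : ℝ) :
    ContDiff ℝ ((⊤ : ℕ∞)) (segInt v a b h) :=
  contDiff_infty.2 fun n => contDiff_segInt_nat n (contDiff_infty.1 hh n) v a b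

lemma fderiv_segInt_apply {h : Pt d → E} (hh : ContDiff ℝ 1 h) (v w : Pt d) (a b : ℝ)
    (x : Pt d) :
    fderiv ℝ (segInt v a b h) x w = segInt v a b (fun y => fderiv ℝ h y w) x := by
  have hc : Continuous (fderiv ℝ h) := hh.continuous_fderiv one_ne_zero
  rw [(hasFDerivAt_segInt hh v a b x).fderiv, segInt, segInt,
    ContinuousLinearMap.intervalIntegral_apply]
  · simp
  · exact ((continuous_segInt_integrand hc v a b).comp
      (Continuous.prodMk_right x)).intervalIntegrable _ _

lemma segInt_fderiv_self {h : Pt d → ℝ} (hh : ContDiff ℝ 1 h) (v : Pt d) (a b : ℝ) (x : Pt d) :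
    a * segInt v 0 1 h x + segInt v a b (fun y => fderiv ℝ h y v) x
      = (a + b) * h (x + v) - b * h x := by
  have hc : Continuous (fderiv ℝ h) := hh.continuous_fderiv one_ne_zero
  have hder : ∀ t ∈ Set.uIcc (0 : ℝ) 1, HasDerivAt (fun t => (a * t + b) * h (x + t • v))
      (a * h (x + t • v) + (a * t + b) * fderiv ℝ h (x + t • v) v) t := by
    intro t _
    have h1 : HasFDerivAt h (fderiv ℝ h (x + t • v)) (x + t • v) :=
      (hh.differentiable one_ne_zero _).hasFDerivAt
    have h2 : HasDerivAt (fun t : ℝ => x + t • v) v t := by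
      simpa using ((hasDerivAt_id t).smul_const v).const_add x
    have h3 : HasDerivAt (fun t : ℝ => a * t + b) a t := by
      simpa using ((hasDerivAt_id t).const_mul a).add_const b
    exact h3.mul (h1.comp_hasDerivAt t h2)
  have hh0 := hh.continuous
  have i1 : IntervalIntegrable (fun t : ℝ => a * h (x + t • v)) volume 0 1 :=
    Continuous.intervalIntegrable (by fun_prop) _ _
  have i2 : IntervalIntegrable (fun t : ℝ => (a * t + b) * fderiv ℝ h (x + t • v) v) volume 0 1 :=
    Continuous.intervalIntegrable (by fun_prop) _ _
  have := intervalIntegral.integral_eq_sub_of_hasDerivAt hder (i1.add i2)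
  rw [intervalIntegral.integral_add i1 i2, intervalIntegral.integral_const_mul] at this
  simpa [segInt] using this

lemma ZPer.segInt {h : Pt d → E} (hp : ZPer h) (v : Pt d) (a b : ℝ) :
    ZPer (NonNewtonian.segInt v a b h) := by
  intro x m
  simp only [NonNewtonian.segInt]
  congr 1
  funext t
  rw [add_right_comm, hp]

lemma abs_affine_le {a b : ℝ} (hb : |b| ≤ 1) (hab : |a + b| ≤ 1) {t : ℝ}
    (ht : t ∈ Set.Ioc (0 : ℝ) 1) : |a * t + b| ≤ 1 := by
  obtain ⟨h0, h1⟩ := ht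
  rw [abs_le] at *
  constructor <;> nlinarith

lemma eLpNorm_segInt_le {h : Pt d → ℝ} (hp : ZPer h) (hh : Continuous h) (v : Pt d) {a b : ℝ}
    (hb : |b| ≤ 1) (hab : |a + b| ≤ 1) {s : ℝ≥0∞} (hs : 1 ≤ s) :
    eLpNorm (segInt v a b h) s (μbox d) ≤ eLpNorm h s (μbox d) := by
  set ν : Measure ℝ := volume.restrict (Set.Ioc (0 : ℝ) 1) with hν
  have : IsProbabilityMeasure ν := ⟨by simp [hν]⟩
  have hcont : Continuous (fun q : Pt d × ℝ => h (q.1 + q.2 • v)) := by fun_prop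
  have hpt : ∀ x, ‖segInt v a b h x‖ₑ ≤ eLpNorm (fun t : ℝ => h (x + t • v)) s ν := by
    intro x
    calc ‖segInt v a b h x‖ₑ ≤ ∫⁻ t, ‖(a * t + b) • h (x + t • v)‖ₑ ∂ν := by
          rw [segInt, intervalIntegral.integral_of_le zero_le_one]
          exact enorm_integral_le_lintegral_enorm _
      _ ≤ ∫⁻ t, ‖h (x + t • v)‖ₑ ∂ν := by
          refine lintegral_mono_ae ((ae_restrict_iff' measurableSet_Ioc).2
            (Filter.Eventually.of_forall fun t ht => ?_))
          rw [enorm_le_iff_norm_le, norm_smul]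
          exact mul_le_of_le_one_left (norm_nonneg _) (abs_affine_le hb hab ht)
      _ = eLpNorm (fun t : ℝ => h (x + t • v)) 1 ν := eLpNorm_one_eq_lintegral_enorm.symm
      _ ≤ _ := eLpNorm_le_eLpNorm_of_exponent_le hs
          (hcont.comp (Continuous.prodMk_right x)).aestronglyMeasurable
  have htr : ∀ t : ℝ, eLpNorm (fun x => h (x + t • v)) s (μbox d) = eLpNorm h s (μbox d) :=
    fun t => (hp.comp_add hh.measurable (t • v)).1 s
  rcases eq_or_ne s ∞ with rfl | hs'
  · simp only [eLpNorm_exponent_top] at *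
    refine eLpNormEssSup_le_of_ae_enorm_bound ?_
    have h1 : ∀ᵐ x ∂μbox d, ∀ᵐ t ∂ν, ‖h (x + t • v)‖ₑ ≤ eLpNormEssSup h (μbox d) := by
      rw [Measure.ae_ae_comm]
      · refine Filter.Eventually.of_forall fun t => ?_
        rw [← htr t]
        exact ae_le_eLpNormEssSup
      · exact measurableSet_le hcont.measurable.enorm measurable_const
    filter_upwards [h1] with x hx
    exact (hpt x).trans (eLpNormEssSup_le_of_ae_enorm_bound hx)
  · have hs0 : s ≠ 0 := (one_pos.trans_le hs).ne'
    have hsr : 0 < s.toReal := ENNReal.toReal_pos hs0 hs'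
    rw [eLpNorm_eq_lintegral_rpow_enorm_toReal hs0 hs',
      eLpNorm_eq_lintegral_rpow_enorm_toReal hs0 hs']
    refine ENNReal.rpow_le_rpow ?_ (by positivity)
    calc ∫⁻ x, ‖segInt v a b h x‖ₑ ^ s.toReal ∂μbox d
        ≤ ∫⁻ x, ∫⁻ t, ‖h (x + t • v)‖ₑ ^ s.toReal ∂ν ∂μbox d := by
          refine lintegral_mono fun x => ?_
          refine (ENNReal.rpow_le_rpow (hpt x) hsr.le).trans ?_
          rw [eLpNorm_eq_lintegral_rpow_enorm_toReal hs0 hs', ← ENNReal.rpow_mul,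
            one_div_mul_cancel hsr.ne', ENNReal.rpow_one]
      _ = ∫⁻ t, ∫⁻ x, ‖h (x + t • v)‖ₑ ^ s.toReal ∂μbox d ∂ν :=
          lintegral_lintegral_swap (hcont.measurable.enorm.pow_const _).aemeasurable
      _ = ∫⁻ _, ∫⁻ x, ‖h x‖ₑ ^ s.toReal ∂μbox d ∂ν := by
          refine lintegral_congr fun t => ?_
          have := htr t
          rw [eLpNorm_eq_lintegral_rpow_enorm_toReal hs0 hs',
            eLpNorm_eq_lintegral_rpow_enorm_toReal hs0 hs'] at this
          exact (ENNReal.rpow_left_injective (by positivity)) this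
      _ = _ := by simp

lemma integral_segInt {h : Pt d → ℝ} (hp : ZPer h) (hh : Continuous h) (v : Pt d) :
    ∫ x, segInt v 0 1 h x ∂μbox d = ∫ x, h x ∂μbox d := by
  set ν : Measure ℝ := volume.restrict (Set.Ioc (0 : ℝ) 1) with hν
  have : IsProbabilityMeasure ν := ⟨by simp [hν]⟩
  have hcont : Continuous (fun q : Pt d × ℝ => h (q.1 + q.2 • v)) := by fun_prop
  have hint : Integrable (fun q : Pt d × ℝ => h (q.1 + q.2 • v)) ((μbox d).prod ν) := by
    rw [μbox, hν, Measure.prod_restrict]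
    refine IntegrableOn.mono_set ?_ (Set.prod_mono_right Set.Ioc_subset_Icc_self)
    exact hcont.continuousOn.integrableOn_compact (isCompact_Icc.prod isCompact_Icc)
  calc ∫ x, segInt v 0 1 h x ∂μbox d = ∫ x, ∫ t, h (x + t • v) ∂ν ∂μbox d := by
        simp [segInt, intervalIntegral.integral_of_le, hν]
    _ = ∫ t, ∫ x, h (x + t • v) ∂μbox d ∂ν := integral_integral_swap hint
    _ = ∫ t, ∫ x, h x ∂μbox d ∂ν := by
        congr 1
        funext t
        exact (hp.comp_add hh.measurable (t • v)).2
    _ = _ := by simp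

end segInt

/-- The algebra of smooth functions on the torus. -/
def torusFun (d : ℕ) : Subalgebra ℝ (Pt d → ℝ) where
  carrier := {f | AdmissibleScal d f}
  mul_mem' := fun ⟨h1, h2⟩ ⟨h3, h4⟩ => ⟨h1.mul h3, fun x m => by simp [h2 x m, h4 x m]⟩
  add_mem' := fun ⟨h1, h2⟩ ⟨h3, h4⟩ => ⟨h1.add h3, fun x m => by simp [h2 x m, h4 x m]⟩
  algebraMap_mem' := fun _ => ⟨contDiff_const, fun _ _ => rfl⟩

/-- Smooth functions on the torus. -/
abbrev TorusFn (d : ℕ) : Type := torusFun d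

section torusFun

variable {d : ℕ}

lemma TorusFn.contDiff (f : TorusFn d) : ContDiff ℝ ((⊤ : ℕ∞)) f.1 := f.2.1

lemma TorusFn.contDiff_one (f : TorusFn d) : ContDiff ℝ 1 f.1 :=
  f.2.1.of_le (by exact_mod_cast le_top)

lemma TorusFn.differentiableAt (f : TorusFn d) (x : Pt d) : DifferentiableAt ℝ f.1 x :=
  f.contDiff_one.differentiable one_ne_zero x

lemma TorusFn.continuous (f : TorusFn d) : Continuous f.1 := f.2.1.continuous

lemma TorusFn.zPer (f : TorusFn d) : ZPer f.1 := f.2.2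

lemma ZPer.fderiv {E : Type} [NormedAddCommGroup E] [NormedSpace ℝ E] {h : Pt d → E}
    (hp : ZPer h) : ZPer (_root_.fderiv ℝ h) := by
  intro x m
  rw [← fderiv_comp_add_right]
  congr 1
  funext y
  exact hp y m

/-- The standard basis vectors. -/
def basisVec (i : Fin d) : Pt d := Pi.single i 1

/-- The partial derivative `∂_i` on smooth functions on the torus. -/
def pderiv (i : Fin d) : TorusFn d →ₗ[ℝ] TorusFn d where
  toFun f := ⟨fun x => fderiv ℝ f.1 x (basisVec i),
    (f.contDiff.fderiv_right (m := ((⊤ : ℕ∞))) (by simp)).clm_apply contDiff_const,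
    fun x m => congrArg (fun L => L (basisVec i)) (f.zPer.fderiv x m)⟩
  map_add' f g := by
    ext x
    simp [fderiv_add (f.differentiableAt x) (g.differentiableAt x)]
  map_smul' c f := by
    ext x
    simp [fderiv_const_smul (f.differentiableAt x)]

lemma pderiv_apply (i : Fin d) (f : TorusFn d) (x : Pt d) :
    (pderiv i f).1 x = fderiv ℝ f.1 x (basisVec i) := rfl

lemma pderiv_mul (i : Fin d) (f g : TorusFn d) :
    pderiv i (f * g) = pderiv i f * g + f * pderiv i g := by
  ext x
  simp [pderiv_apply, fderiv_mul (f.differentiableAt x) (g.differentiableAt x)]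
  ring

/-- The weighted segment average `segInt` on smooth functions on the torus. -/
def segAvg (v : Pt d) (a b : ℝ) : TorusFn d →ₗ[ℝ] TorusFn d where
  toFun f := ⟨segInt v a b f.1, contDiff_segInt f.contDiff v a b, f.zPer.segInt v a b⟩
  map_add' f g := by
    ext x
    have hi : ∀ u : TorusFn d, IntervalIntegrable (fun t : ℝ => (a * t + b) • u.1 (x + t • v))
        volume 0 1 := fun u => by
      have := u.continuous
      exact Continuous.intervalIntegrable (by fun_prop) _ _
    simp only [segInt, Subalgebra.coe_add, Pi.add_apply, smul_add]
    exact intervalIntegral.integral_add (hi f) (hi g)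
  map_smul' c f := by
    ext x
    simp only [segInt, Subalgebra.coe_smul, Pi.smul_apply, RingHom.id_apply]
    rw [← intervalIntegral.integral_smul]
    simp only [smul_comm c]

lemma pderiv_segAvg (i : Fin d) (v : Pt d) (a b : ℝ) (f : TorusFn d) :
    pderiv i (segAvg v a b f) = segAvg v a b (pderiv i f) := by
  ext x
  exact fderiv_segInt_apply f.contDiff_one v _ a b x

/-- The mean in the `i`-th variable. -/
def coordMean (i : Fin d) : TorusFn d →ₗ[ℝ] TorusFn d := segAvg (basisVec i) 0 1

/-- The mean-zero periodic primitive in the `i`-th variable. -/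
def coordPrim (i : Fin d) : TorusFn d →ₗ[ℝ] TorusFn d := segAvg (basisVec i) 1 (-(1 / 2))

lemma pderiv_coordPrim_comm (i k : Fin d) (f : TorusFn d) :
    pderiv i (coordPrim k f) = coordPrim k (pderiv i f) := pderiv_segAvg ..

lemma pderiv_coordMean_comm (i k : Fin d) (f : TorusFn d) :
    pderiv i (coordMean k f) = coordMean k (pderiv i f) := pderiv_segAvg ..

lemma TorusFn.apply_add_basisVec (f : TorusFn d) (i : Fin d) (x : Pt d) :
    f.1 (x + basisVec i) = f.1 x := by
  have := f.zPer x (Pi.single i 1)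
  rwa [show (fun k => (((Pi.single i 1 : Fin d → ℤ) k : ℤ) : ℝ)) = basisVec i by
    funext k; by_cases h : k = i <;> simp [basisVec, h]] at this

lemma pderiv_coordPrim (i : Fin d) (f : TorusFn d) :
    pderiv i (coordPrim i f) = f - coordMean i f := by
  ext x
  have := segInt_fderiv_self f.contDiff_one (basisVec i) 1 (-(1 / 2)) x
  rw [f.apply_add_basisVec] at this
  rw [pderiv_coordPrim_comm]
  change segInt _ _ _ (fun y => fderiv ℝ f.1 y (basisVec i)) x = f.1 x - segInt _ _ _ f.1 x
  linarith

lemma coordMean_pderiv (i : Fin d) (f : TorusFn d) : coordMean i (pderiv i f) = 0 := by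
  ext x
  have := segInt_fderiv_self f.contDiff_one (basisVec i) 0 1 x
  rw [f.apply_add_basisVec] at this
  change segInt _ _ _ (fun y => fderiv ℝ f.1 y (basisVec i)) x = 0
  linarith

lemma pderiv_coordMean (i : Fin d) (f : TorusFn d) : pderiv i (coordMean i f) = 0 := by
  rw [pderiv_coordMean_comm, coordMean_pderiv]

lemma TorusFn.apply_add_smul_of_pderiv_eq_zero {f : TorusFn d} {i : Fin d} (hf : pderiv i f = 0)
    (x : Pt d) (t : ℝ) : f.1 (x + t • basisVec i) = f.1 x := by
  have := segInt_fderiv_self f.contDiff_one (t • basisVec i) 0 1 x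
  have h0 : (fun y => fderiv ℝ f.1 y (t • basisVec i)) = fun _ => 0 := by
    funext y
    rw [map_smul, ← pderiv_apply, hf]
    simp
  rw [h0] at this
  simp [segInt] at this
  linarith

lemma coordPrim_coordMean (i : Fin d) (f : TorusFn d) : coordPrim i (coordMean i f) = 0 := by
  ext x
  change segInt _ _ _ (coordMean i f).1 x = 0
  simp only [segInt, TorusFn.apply_add_smul_of_pderiv_eq_zero (pderiv_coordMean i f)]
  rw [intervalIntegral.integral_smul_const, intervalIntegral.integral_add
    (Continuous.intervalIntegrable (by fun_prop) _ _)
    (Continuous.intervalIntegrable (by fun_prop) _ _)]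
  norm_num

lemma coordMean_coordPrim (i : Fin d) (f : TorusFn d) : coordMean i (coordPrim i f) = 0 := by
  have h1 := pderiv_coordPrim i (coordPrim i f)
  have h2 := congrArg (coordPrim i) (pderiv_coordPrim i f)
  rw [pderiv_coordPrim_comm, h2, map_sub, coordPrim_coordMean, sub_zero] at h1
  exact (sub_eq_self.1 h1.symm)

/-- The dilation `f ↦ f(n ·)` of functions on the torus. -/
def dilate (n : ℕ) : TorusFn d →ₗ[ℝ] TorusFn d where
  toFun f := ⟨fun x => f.1 (fun i => (n : ℝ) * x i), f.contDiff.comp (by fun_prop), fun x m => by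
    have := f.zPer (fun i => (n : ℝ) * x i) (fun i => n * m i)
    refine Eq.trans (congrArg f.1 ?_) this
    funext i
    simp [mul_add]⟩
  map_add' f g := rfl
  map_smul' c f := rfl

lemma dilate_apply (n : ℕ) (f : TorusFn d) (x : Pt d) :
    (dilate n f).1 x = f.1 ((n : ℝ) • x) := rfl

lemma pderiv_dilate (n : ℕ) (i : Fin d) (f : TorusFn d) :
    pderiv i (dilate n f) = (n : ℝ) • dilate n (pderiv i f) := by
  ext x
  have h1 : HasFDerivAt f.1 (fderiv ℝ f.1 ((n : ℝ) • x)) ((n : ℝ) • x) :=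
    (f.differentiableAt _).hasFDerivAt
  have h2 : HasFDerivAt (fun y : Pt d => (n : ℝ) • y)
      ((n : ℝ) • ContinuousLinearMap.id ℝ (Pt d)) x :=
    ((n : ℝ) • ContinuousLinearMap.id ℝ (Pt d)).hasFDerivAt
  have h3 := (h1.comp x h2).fderiv
  change fderiv ℝ (f.1 ∘ fun y => (n : ℝ) • y) x (basisVec i) = _
  rw [h3]
  simp only [ContinuousLinearMap.comp_apply, _root_.smul_apply,
    ContinuousLinearMap.id_apply, map_smul]
  rfl

lemma coordMean_dilate {n : ℕ} (hn : n ≠ 0) (i : Fin d) (f : TorusFn d) :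
    coordMean i (dilate n f) = dilate n (coordMean i f) := by
  ext x
  have hn' : (n : ℝ) ≠ 0 := by exact_mod_cast hn
  set u : ℝ → ℝ := fun t => f.1 ((n : ℝ) • x + t • basisVec i) with hu
  have hper : Function.Periodic u 1 := fun t => by
    simp only [hu, add_smul, one_smul, ← add_assoc]
    exact f.apply_add_basisVec i _
  have hc : Continuous u := by
    have := f.continuous
    fun_prop
  have h1 := hper.intervalIntegral_add_zsmul_eq n 0 (fun _ _ => hc.intervalIntegrable _ _)
  have h2 := intervalIntegral.integral_comp_mul_left (a := 0) (b := 1) u hn'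
  change segInt _ _ _ _ x = segInt _ _ _ f.1 ((n : ℝ) • x)
  have e1 : segInt (basisVec i) 0 1 (dilate n f).1 x = ∫ t in (0 : ℝ)..1, u ((n : ℝ) * t) := by
    simp [segInt, dilate_apply, hu, mul_smul]
  have e2 : segInt (basisVec i) 0 1 f.1 ((n : ℝ) • x) = ∫ t in (0 : ℝ)..1, u t := by
    simp [segInt, hu]
  rw [e1, e2, h2]
  simp at h1 ⊢
  rw [h1]
  field_simp

lemma coordPrim_dilate {n : ℕ} (hn : n ≠ 0) (i : Fin d) (f : TorusFn d) :
    coordPrim i (dilate n f) = (n : ℝ)⁻¹ • dilate n (coordPrim i f) := by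
  have hn' : (n : ℝ) ≠ 0 := by exact_mod_cast hn
  set w := coordPrim i (dilate n f) - (n : ℝ)⁻¹ • dilate n (coordPrim i f) with hw
  have h1 : pderiv i w = 0 := by
    rw [hw, map_sub, map_smul, pderiv_dilate, pderiv_coordPrim, pderiv_coordPrim, map_sub,
      coordMean_dilate hn, smul_smul, inv_mul_cancel₀ hn', one_smul, sub_self]
  have h2 : coordMean i w = 0 := by
    rw [hw, map_sub, map_smul, coordMean_dilate hn, coordMean_coordPrim, coordMean_coordPrim]
    simp
  have h3 := pderiv_coordPrim i w
  rw [pderiv_coordPrim_comm, h1, h2, map_zero, sub_zero] at h3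
  exact sub_eq_zero.1 h3.symm

end torusFun

section norms

variable {d : ℕ}

lemma memLp_of_continuous {E : Type} [NormedAddCommGroup E] [SecondCountableTopology E]
    {h : Pt d → E} (hh : Continuous h) (s : ℝ≥0∞) : MemLp h s (μbox d) := by
  have hK : IsCompact (box d) := isCompact_Icc
  obtain ⟨M, hM⟩ := hK.exists_bound_of_continuousOn hh.continuousOn
  refine MemLp.of_bound hh.aestronglyMeasurable M ?_
  exact (ae_restrict_iff' hK.measurableSet).2 (Filter.Eventually.of_forall hM)

lemma TorusFn.memLp (f : TorusFn d) (s : ℝ≥0∞) : MemLp f.1 s (μbox d) :=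
  memLp_of_continuous f.continuous s

lemma TorusFn.integrable (f : TorusFn d) : Integrable f.1 (μbox d) :=
  memLp_one_iff_integrable.1 (f.memLp 1)

/-- The (real-valued) `L^s` norm on the torus. -/
def lpNm (s : ℝ≥0∞) (f : TorusFn d) : ℝ := (eLpNorm f.1 s (μbox d)).toReal

lemma ofReal_lpNm (s : ℝ≥0∞) (f : TorusFn d) :
    ENNReal.ofReal (lpNm s f) = eLpNorm f.1 s (μbox d) :=
  ENNReal.ofReal_toReal (f.memLp s).2.ne

lemma lpNm_nonneg (s : ℝ≥0∞) (f : TorusFn d) : 0 ≤ lpNm s f := ENNReal.toReal_nonneg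

lemma lpNm_add_le {s : ℝ≥0∞} (hs : 1 ≤ s) (f g : TorusFn d) :
    lpNm s (f + g) ≤ lpNm s f + lpNm s g := by
  unfold lpNm
  rw [← ENNReal.toReal_add (f.memLp s).2.ne (g.memLp s).2.ne]
  exact ENNReal.toReal_mono (ENNReal.add_ne_top.2 ⟨(f.memLp s).2.ne, (g.memLp s).2.ne⟩)
    (eLpNorm_add_le (f.memLp s).1 (g.memLp s).1 hs)

lemma lpNm_smul (s : ℝ≥0∞) (c : ℝ) (f : TorusFn d) : lpNm s (c • f) = |c| * lpNm s f := by
  unfold lpNm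
  rw [Subalgebra.coe_smul, eLpNorm_const_smul, ENNReal.toReal_mul]
  simp

lemma lpNm_segAvg_le {s : ℝ≥0∞} (hs : 1 ≤ s) (v : Pt d) {a b : ℝ} (hb : |b| ≤ 1)
    (hab : |a + b| ≤ 1) (f : TorusFn d) : lpNm s (segAvg v a b f) ≤ lpNm s f :=
  ENNReal.toReal_mono (f.memLp s).2.ne (eLpNorm_segInt_le f.zPer f.continuous v hb hab hs)

lemma lpNm_mul_le {p r s : ℝ≥0∞} (h : 1 / p = 1 / s + 1 / r) (f g : TorusFn d) :
    lpNm p (f * g) ≤ lpNm r f * lpNm s g := by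
  have : HolderTriple r s p := ⟨by simpa [add_comm] using h.symm⟩
  unfold lpNm
  rw [← ENNReal.toReal_mul]
  exact ENNReal.toReal_mono (ENNReal.mul_ne_top (f.memLp r).2.ne (g.memLp s).2.ne)
    ((congrArg (fun u => eLpNorm u p (μbox d)) (Subalgebra.coe_mul _ f g)).trans_le
      (eLpNorm_smul_le_mul_eLpNorm (φ := f.1) (f := g.1) (g.memLp s).1 (f.memLp r).1))

lemma lpNm_dilate (s : ℝ≥0∞) {n : ℕ} (hn : n ≠ 0) (f : TorusFn d) :
    lpNm s (dilate n f) = lpNm s f :=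
  congrArg ENNReal.toReal (f.zPer.comp_scale f.continuous.measurable hn s)

lemma lpNm_translate_sub_le {s : ℝ≥0∞} (hs : 1 ≤ s) (δ : ℝ) (i : Fin d) (f : TorusFn d) :
    |δ| * lpNm s (pderiv i f) ≤ 2 * lpNm s f + δ ^ 2 * lpNm s (pderiv i (pderiv i f)) := by
  set v : Pt d := δ • basisVec i with hv
  let τ : TorusFn d := ⟨fun x => f.1 (x + v), f.contDiff.comp (by fun_prop), fun x m => by
    change f.1 (x + _ + v) = f.1 (x + v)
    rw [add_right_comm]
    exact f.zPer _ m⟩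
  have hτ : lpNm s τ = lpNm s f :=
    congrArg ENNReal.toReal ((f.zPer.comp_add f.continuous.measurable v).1 s)
  have hdv : ∀ (g : TorusFn d) (y : Pt d), fderiv ℝ g.1 y v = δ * (pderiv i g).1 y := fun g y => by
    rw [hv, map_smul, pderiv_apply, smul_eq_mul]
  have h1 := fun x => segInt_fderiv_self f.contDiff_one v 0 1 x
  have h2 := fun x => segInt_fderiv_self (pderiv i f).contDiff_one v 1 (-1) x
  have e1 : segAvg v 0 1 (δ • pderiv i f) = τ - f := by
    ext x
    have h3 : (fun y => fderiv ℝ f.1 y v) = (δ • pderiv i f).1 := funext fun y => hdv f y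
    have h4 := h1 x
    rw [h3] at h4
    change segInt v 0 1 _ x = f.1 (x + v) - f.1 x
    linarith
  have e2 : segAvg v 0 1 (pderiv i f) + segAvg v 1 (-1) (δ • pderiv i (pderiv i f))
      = pderiv i f := by
    ext x
    have h3 : (fun y => fderiv ℝ (pderiv i f).1 y v) = (δ • pderiv i (pderiv i f)).1 :=
      funext fun y => hdv (pderiv i f) y
    have h4 := h2 x
    rw [h3] at h4
    change segInt v 0 1 _ x + segInt v 1 (-1) _ x = (pderiv i f).1 x
    linarith
  have e3 : δ • pderiv i f =
      τ + (-1 : ℝ) • f + δ ^ 2 • segAvg v 1 (-1) (pderiv i (pderiv i f)) := by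
    have e4 := congrArg (δ • ·) e2
    simp only [smul_add, map_smul] at e4 e1
    rw [← e4, e1]
    module
  calc |δ| * lpNm s (pderiv i f) = lpNm s (δ • pderiv i f) := (lpNm_smul ..).symm
    _ ≤ lpNm s f + lpNm s f + δ ^ 2 * lpNm s (pderiv i (pderiv i f)) := by
      rw [e3]
      refine (lpNm_add_le hs _ _).trans (add_le_add ((lpNm_add_le hs _ _).trans ?_) ?_)
      · rw [hτ, lpNm_smul]
        simp
      · rw [lpNm_smul, abs_of_nonneg (sq_nonneg δ)]
        gcongr
        exact lpNm_segAvg_le hs v (by norm_num) (by norm_num) _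
    _ = _ := by ring

/-- The sum of the `L^s` norms of all derivatives of order `m`. -/
def sobNm (s : ℝ≥0∞) : ℕ → TorusFn d → ℝ
  | 0, f => lpNm s f
  | m + 1, f => ∑ i, sobNm s m (pderiv i f)

lemma sobNm_nonneg (s : ℝ≥0∞) (m : ℕ) (f : TorusFn d) : 0 ≤ sobNm s m f := by
  induction m generalizing f with
  | zero => exact lpNm_nonneg s f
  | succ m ih => exact Finset.sum_nonneg fun i _ => ih _

lemma sobNm_add_le {s : ℝ≥0∞} (hs : 1 ≤ s) (m : ℕ) (f g : TorusFn d) :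
    sobNm s m (f + g) ≤ sobNm s m f + sobNm s m g := by
  induction m generalizing f g with
  | zero => exact lpNm_add_le hs f g
  | succ m ih =>
    simp only [sobNm, map_add, ← Finset.sum_add_distrib]
    exact Finset.sum_le_sum fun i _ => ih _ _

lemma sobNm_smul (s : ℝ≥0∞) (m : ℕ) (c : ℝ) (f : TorusFn d) :
    sobNm s m (c • f) = |c| * sobNm s m f := by
  induction m generalizing f with
  | zero => exact lpNm_smul s c f
  | succ m ih => simp only [sobNm, map_smul, ih, Finset.mul_sum]

lemma sobNm_sub_le {s : ℝ≥0∞} (hs : 1 ≤ s) (m : ℕ) (f g : TorusFn d) :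
    sobNm s m (f - g) ≤ sobNm s m f + sobNm s m g := by
  have := sobNm_add_le hs m f ((-1 : ℝ) • g)
  rw [sobNm_smul] at this
  simpa [sub_eq_add_neg] using this

lemma sobNm_sum_le {ι : Type} {s : ℝ≥0∞} (hs : 1 ≤ s) (m : ℕ) (S : Finset ι) (f : ι → TorusFn d) :
    sobNm s m (∑ i ∈ S, f i) ≤ ∑ i ∈ S, sobNm s m (f i) := by
  classical
  induction S using Finset.induction_on with
  | empty =>
    have := sobNm_smul s m 0 (0 : TorusFn d)
    simp at this
    simp [this]
  | insert a S ha ih =>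
    rw [Finset.sum_insert ha, Finset.sum_insert ha]
    exact (sobNm_add_le hs m _ _).trans (by gcongr)

lemma sobNm_segAvg_le {s : ℝ≥0∞} (hs : 1 ≤ s) (v : Pt d) {a b : ℝ} (hb : |b| ≤ 1)
    (hab : |a + b| ≤ 1) (m : ℕ) (f : TorusFn d) : sobNm s m (segAvg v a b f) ≤ sobNm s m f := by
  induction m generalizing f with
  | zero => exact lpNm_segAvg_le hs v hb hab f
  | succ m ih =>
    simp only [sobNm, pderiv_segAvg]
    exact Finset.sum_le_sum fun i _ => ih _

lemma sobNm_coordMean_le {s : ℝ≥0∞} (hs : 1 ≤ s) (i : Fin d) (m : ℕ) (f : TorusFn d) :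
    sobNm s m (coordMean i f) ≤ sobNm s m f :=
  sobNm_segAvg_le hs _ (by norm_num) (by norm_num) m f

lemma sobNm_coordPrim_le {s : ℝ≥0∞} (hs : 1 ≤ s) (i : Fin d) (m : ℕ) (f : TorusFn d) :
    sobNm s m (coordPrim i f) ≤ sobNm s m f :=
  sobNm_segAvg_le hs _ (by norm_num [abs_le]) (by norm_num [abs_le]) m f

lemma sobNm_dilate (s : ℝ≥0∞) {n : ℕ} (hn : n ≠ 0) (m : ℕ) (f : TorusFn d) :
    sobNm s m (dilate n f) = (n : ℝ) ^ m * sobNm s m f := by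
  induction m generalizing f with
  | zero => simpa [sobNm] using lpNm_dilate s hn f
  | succ m ih =>
    simp only [sobNm, pderiv_dilate, sobNm_smul, ih, Finset.mul_sum]
    simp [pow_succ]
    exact Finset.sum_congr rfl fun _ _ => by ring

lemma sobNm_pderiv_le (s : ℝ≥0∞) (i : Fin d) (m : ℕ) (f : TorusFn d) :
    sobNm s m (pderiv i f) ≤ sobNm s (m + 1) f :=
  Finset.single_le_sum (f := fun i => sobNm s m (pderiv i f)) (fun _ _ => sobNm_nonneg s m _)
    (Finset.mem_univ i)

lemma sobNm_iterate_pderiv_le (s : ℝ≥0∞) (i : Fin d) (k m : ℕ) (f : TorusFn d) :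
    sobNm s m ((pderiv i)^[k] f) ≤ sobNm s (m + k) f := by
  induction k generalizing f with
  | zero => exact le_rfl
  | succ k ih => exact (ih _).trans (sobNm_pderiv_le s i (m + k) f)

lemma sobNm_mul_le {p r s : ℝ≥0∞} (hp : 1 ≤ p) (h : 1 / p = 1 / s + 1 / r) {c F G : ℝ}
    (hF : 0 ≤ F) (hG : 0 ≤ G) (hc : 0 ≤ c)
    (m : ℕ) (f g : TorusFn d) (hf : ∀ a ≤ m, sobNm r a f ≤ F * c ^ a)
    (hg : ∀ a ≤ m, sobNm s a g ≤ G * c ^ a) :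
    sobNm p m (f * g) ≤ (2 * d) ^ m * (F * G * c ^ m) := by
  induction m generalizing f g F G with
  | zero =>
    have h1 := hf 0 le_rfl
    have h2 := hg 0 le_rfl
    simp only [sobNm, pow_zero, mul_one, one_mul] at h1 h2 ⊢
    exact (lpNm_mul_le h f g).trans (mul_le_mul h1 h2 (lpNm_nonneg _ _) hF)
  | succ m ih =>
    have key : ∀ i : Fin d, sobNm p m (pderiv i (f * g))
        ≤ 2 * ((2 * d) ^ m * (F * G * c ^ (m + 1))) := by
      intro i
      rw [pderiv_mul]
      refine (sobNm_add_le hp m _ _).trans ?_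
      have h1 := ih (F := F * c) (G := G) (by positivity) hG (pderiv i f) g
        (fun a ha => (sobNm_pderiv_le r i a f).trans
          ((hf (a + 1) (by omega)).trans_eq (by ring))) (fun a ha => hg a (by omega))
      have h2 := ih (F := F) (G := G * c) hF (by positivity) f (pderiv i g)
        (fun a ha => hf a (by omega)) (fun a ha => (sobNm_pderiv_le s i a g).trans
          ((hg (a + 1) (by omega)).trans_eq (by ring)))
      refine (add_le_add h1 h2).trans_eq (by ring)
    calc sobNm p (m + 1) (f * g) ≤ ∑ _i : Fin d, 2 * ((2 * d) ^ m * (F * G * c ^ (m + 1))) :=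
          Finset.sum_le_sum fun i _ => key i
      _ = _ := by
        simp
        ring

lemma sobNm_interpolation {s : ℝ≥0∞} (hs : 1 ≤ s) {δ : ℝ} (hδ : 0 ≤ δ) (m : ℕ) (f : TorusFn d) :
    δ * sobNm s (m + 1) f ≤ 2 * d * sobNm s m f + δ ^ 2 * sobNm s (m + 2) f := by
  induction m generalizing f with
  | zero =>
    have key : ∀ i : Fin d, δ * lpNm s (pderiv i f)
        ≤ 2 * lpNm s f + δ ^ 2 * ∑ k, lpNm s (pderiv k (pderiv i f)) := fun i => by
      have h1 := lpNm_translate_sub_le hs δ i f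
      rw [abs_of_nonneg hδ] at h1
      refine h1.trans ?_
      gcongr
      exact Finset.single_le_sum (f := fun k => lpNm s (pderiv k (pderiv i f)))
        (fun _ _ => lpNm_nonneg s _) (Finset.mem_univ i)
    simp only [sobNm]
    rw [Finset.mul_sum]
    refine (Finset.sum_le_sum fun i _ => key i).trans_eq ?_
    rw [Finset.sum_add_distrib, ← Finset.mul_sum, ← Finset.mul_sum]
    simp only [Finset.sum_const, Finset.card_univ, Fintype.card_fin, nsmul_eq_mul]
    ring
  | succ m ih =>
    rw [sobNm, Finset.mul_sum]
    refine (Finset.sum_le_sum fun i _ => ih (pderiv i f)).trans_eq ?_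
    rw [Finset.sum_add_distrib, ← Finset.mul_sum, ← Finset.mul_sum]
    rfl

end norms

section interpolation

/-- A sequence satisfying multiplicative-type interpolation between neighbours. -/
def Interpolates (K : ℝ) (b : ℕ → ℝ) : Prop :=
  (∀ m, 0 ≤ b m) ∧ ∀ m δ, 0 ≤ δ → δ * b (m + 1) ≤ K * b m + δ ^ 2 * b (m + 2)

lemma Interpolates.shift {K : ℝ} {b : ℕ → ℝ} (h : Interpolates K b) (k : ℕ) :
    Interpolates K fun m => b (k + m) :=
  ⟨fun _ => h.1 _, fun m δ hδ => h.2 (k + m) δ hδ⟩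

lemma exists_interpolation_step {K : ℝ} (hK : 0 ≤ K) (n : ℕ) : ∀ ε : ℝ, 0 < ε → ∃ C : ℝ, 0 ≤ C ∧
    ∀ b, Interpolates K b → b n ≤ C * b 0 + ε * b (n + 1) := by
  induction n with
  | zero =>
    intro ε hε
    exact ⟨1, zero_le_one, fun b hb => by have := mul_nonneg hε.le (hb.1 1); linarith⟩
  | succ n ih =>
    intro ε hε
    obtain ⟨C, hC, h⟩ := ih (ε / (4 * (K + 1))) (by positivity)
    refine ⟨4 * K * C / ε, by positivity, fun b hb => ?_⟩
    have h1 := h b hb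
    have h2 := hb.2 n (ε / 2) (by positivity)
    have h3 : K * (ε / (4 * (K + 1)) * b (n + 1)) ≤ ε / 4 * b (n + 1) := by
      have : K * (ε / (4 * (K + 1))) ≤ ε / 4 := by
        rw [mul_div_assoc', div_le_div_iff₀ (by positivity) (by norm_num)]
        nlinarith
      rw [← mul_assoc]
      exact mul_le_mul_of_nonneg_right this (hb.1 _)
    have h4 := mul_le_mul_of_nonneg_left h1 hK
    have h5 : ε / 4 * b (n + 1) ≤ K * C * b 0 + ε ^ 2 / 4 * b (n + 2) := by nlinarith
    have h6 : ε / 4 * (4 * K * C / ε * b 0 + ε * b (n + 1 + 1))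
        = K * C * b 0 + ε ^ 2 / 4 * b (n + 2) := by
      field_simp
    rw [← h6] at h5
    exact le_of_mul_le_mul_left h5 (by positivity)

lemma exists_interpolation {K : ℝ} (hK : 0 ≤ K) (n : ℕ) : ∃ C : ℝ, 0 ≤ C ∧
    ∀ b, Interpolates K b → ∀ m ≤ n, b m ≤ C * (b 0 + b n) := by
  induction n with
  | zero =>
    refine ⟨1, zero_le_one, fun b hb m hm => ?_⟩
    have := hb.1 0
    rw [Nat.le_zero.1 hm]
    linarith
  | succ n ih =>
    obtain ⟨C, hC, h⟩ := ih
    obtain ⟨C', hC', h'⟩ := exists_interpolation_step hK n 1 one_pos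
    refine ⟨1 + C * (1 + C'), by positivity, fun b hb m hm => ?_⟩
    have b0 := hb.1 0
    have b1 := hb.1 (n + 1)
    have p1 : 0 ≤ C * (1 + C') := by positivity
    rcases Nat.le_succ_iff.1 hm with hm | rfl
    · have h1 := h b hb m hm
      have h2 := mul_le_mul_of_nonneg_left (h' b hb) hC
      nlinarith [mul_nonneg hC (mul_nonneg hC' b1)]
    · nlinarith [mul_nonneg p1 b0, mul_nonneg p1 b1]

variable {d : ℕ}

lemma interpolates_sobNm {s : ℝ≥0∞} (hs : 1 ≤ s) {c : ℝ} (hc : 0 < c) (f : TorusFn d) :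
    Interpolates (2 * d) fun m => (c ^ m)⁻¹ * sobNm s m f := by
  refine ⟨fun m => mul_nonneg (by positivity) (sobNm_nonneg _ _ _), fun m δ hδ => ?_⟩
  have h := mul_le_mul_of_nonneg_left
    (sobNm_interpolation hs (δ := δ / c) (by positivity) m f) (a := (c ^ m)⁻¹) (by positivity)
  refine (Eq.trans_le ?_ h).trans_eq ?_
  · field_simp
    ring
  · field_simp
    ring

/-- Gagliardo–Nirenberg type bounds for intermediate derivatives at the scale `c⁻¹`. -/
lemma exists_sobNm_le (d N M : ℕ) (hNM : N ≤ M) : ∃ C : ℝ, 0 ≤ C ∧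
    ∀ (s : ℝ≥0∞) (_ : 1 ≤ s) (c : ℝ) (_ : 1 ≤ c) (f : TorusFn d) (Φ : ℝ),
      Φ = (c ^ 2)⁻¹ * sobNm s 0 f + (c ^ N)⁻¹ * sobNm s N f + (c ^ M)⁻¹ * sobNm s M f →
      (∀ m ≤ M, sobNm s m f ≤ C * Φ * c ^ (m + 2)) ∧
      (∀ m, N ≤ m → m ≤ M → sobNm s m f ≤ C * Φ * c ^ m) := by
  obtain ⟨C₁, hC₁, h₁⟩ := exists_interpolation (K := 2 * d) (by positivity) M
  obtain ⟨C₂, hC₂, h₂⟩ := exists_interpolation (K := 2 * d) (by positivity) (M - N)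
  refine ⟨C₁ + C₂, by positivity, fun s hs c hc f Φ hΦ => ?_⟩
  have hc0 : 0 < c := by linarith
  have hi := interpolates_sobNm hs hc0 f
  have n0 : 0 ≤ (c ^ 2)⁻¹ * sobNm s 0 f := mul_nonneg (by positivity) (sobNm_nonneg _ _ _)
  have n1 := hi.1 N
  have n2 := hi.1 M
  simp only at n1 n2
  have hΦ0 : 0 ≤ Φ := by linarith
  constructor
  · intro m hm
    have h := h₁ _ hi m hm
    simp only [pow_zero, inv_one, one_mul] at h
    have h3 : sobNm s 0 f + (c ^ M)⁻¹ * sobNm s M f ≤ c ^ 2 * Φ := by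
      have e : sobNm s 0 f = c ^ 2 * ((c ^ 2)⁻¹ * sobNm s 0 f) := by field_simp
      have c2 : 1 ≤ c ^ 2 := one_le_pow₀ hc
      rw [hΦ]
      nlinarith
    calc sobNm s m f = c ^ m * ((c ^ m)⁻¹ * sobNm s m f) := by field_simp
      _ ≤ c ^ m * (C₁ * (c ^ 2 * Φ)) :=
        mul_le_mul_of_nonneg_left (h.trans (by gcongr)) (by positivity)
      _ ≤ c ^ m * ((C₁ + C₂) * (c ^ 2 * Φ)) := by gcongr; linarith
      _ = _ := by ring
  · intro m hNm hm
    have h := h₂ _ (hi.shift N) (m - N) (by omega)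
    simp only [add_zero, Nat.add_sub_cancel' hNm, Nat.add_sub_cancel' hNM] at h
    calc sobNm s m f = c ^ m * ((c ^ m)⁻¹ * sobNm s m f) := by field_simp
      _ ≤ c ^ m * (C₂ * Φ) :=
        mul_le_mul_of_nonneg_left (h.trans (by gcongr; linarith)) (by positivity)
      _ ≤ c ^ m * ((C₁ + C₂) * Φ) := by gcongr; linarith
      _ = _ := by ring

end interpolation

section construction

variable {d : ℕ}

lemma coordMean_coordMean (i : Fin d) (f : TorusFn d) :
    coordMean i (coordMean i f) = coordMean i f := by
  have h := pderiv_coordPrim i (coordMean i f)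
  rw [coordPrim_coordMean, map_zero] at h
  exact (sub_eq_zero.1 h.symm).symm

lemma integral_coordMean (i : Fin d) (f : TorusFn d) :
    ∫ x, (coordMean i f).1 x ∂μbox d = ∫ x, f.1 x ∂μbox d :=
  integral_segInt f.zPer f.continuous (basisVec i)

lemma integral_eq_zero_of_coordMean_eq_zero {i : Fin d} {f : TorusFn d} (h : coordMean i f = 0) :
    ∫ x, f.1 x ∂μbox d = 0 := by
  rw [← integral_coordMean i, h]
  simp

lemma integral_pderiv (i : Fin d) (f : TorusFn d) : ∫ x, (pderiv i f).1 x ∂μbox d = 0 :=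
  integral_eq_zero_of_coordMean_eq_zero (coordMean_pderiv i f)

/-- The mean in the first `n` variables. -/
def partialMean (d : ℕ) : ℕ → TorusFn d →ₗ[ℝ] TorusFn d
  | 0 => LinearMap.id
  | n + 1 => if h : n < d then coordMean ⟨n, h⟩ ∘ₗ partialMean d n else partialMean d n

lemma partialMean_succ (i : Fin d) (f : TorusFn d) :
    partialMean d (i + 1) f = coordMean i (partialMean d i f) := by
  simp [partialMean]

/-- Induction principle for statements on `partialMean`. -/
lemma partialMean_induction {P : TorusFn d → Prop} (n : ℕ) {f : TorusFn d} (h0 : P f)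
    (hs : ∀ i g, P g → P (coordMean i g)) : P (partialMean d n f) := by
  induction n with
  | zero => exact h0
  | succ n ih =>
    rw [partialMean]
    split_ifs with h
    · exact hs _ _ ih
    · exact ih

lemma integral_partialMean (n : ℕ) (f : TorusFn d) :
    ∫ x, (partialMean d n f).1 x ∂μbox d = ∫ x, f.1 x ∂μbox d :=
  partialMean_induction (P := fun g => ∫ x, g.1 x ∂μbox d = ∫ x, f.1 x ∂μbox d) n rfl
    fun i g hg => (integral_coordMean i g).trans hg

lemma sobNm_partialMean_le {s : ℝ≥0∞} (hs : 1 ≤ s) (n m : ℕ) (f : TorusFn d) :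
    sobNm s m (partialMean d n f) ≤ sobNm s m f :=
  partialMean_induction (P := fun g => sobNm s m g ≤ sobNm s m f) n le_rfl
    fun i g hg => (sobNm_coordMean_le hs i m g).trans hg

lemma partialMean_dilate {n : ℕ} (hn : n ≠ 0) (k : ℕ) (f : TorusFn d) :
    partialMean d k (dilate n f) = dilate n (partialMean d k f) := by
  induction k with
  | zero => rfl
  | succ k ih =>
    rw [partialMean]
    split_ifs with h
    · rw [LinearMap.comp_apply, ih, coordMean_dilate hn, LinearMap.comp_apply]
    · exact ih

lemma pderiv_partialMean_eq_zero (i : Fin d) {n : ℕ} (hn : (i : ℕ) < n) (f : TorusFn d) :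
    pderiv i (partialMean d n f) = 0 := by
  induction n with
  | zero => omega
  | succ n ih =>
    rcases Nat.lt_succ_iff_lt_or_eq.1 hn with h | h
    · rw [partialMean]
      split_ifs with h'
      · rw [LinearMap.comp_apply, pderiv_coordMean_comm, ih h, map_zero]
      · exact ih h
    · subst h
      rw [partialMean_succ, pderiv_coordMean]

lemma fderiv_eq_sum (f : TorusFn d) (x : Pt d) :
    fderiv ℝ f.1 x = ∑ i, (pderiv i f).1 x • ContinuousLinearMap.proj (R := ℝ) i := by
  refine ContinuousLinearMap.coe_injective (LinearMap.pi_ext' fun i => ?_)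
  ext
  simp [pderiv_apply, basisVec, Pi.single_apply]

lemma partialMean_apply (f : TorusFn d) (x : Pt d) :
    (partialMean d d f).1 x = ∫ y, f.1 y ∂μbox d := by
  have h0 : ∀ y, fderiv ℝ (partialMean d d f).1 y = 0 := fun y => by
    rw [fderiv_eq_sum]
    simp [pderiv_partialMean_eq_zero]
  have h1 := fun y => is_const_of_fderiv_eq_zero (𝕜 := ℝ)
    (partialMean d d f).differentiableAt h0 y x
  rw [← integral_partialMean d f]
  simp [h1]

/-- The `k`-th primitive in the `i`-th variable of the part of `f` that is independent of the
previous variables and has zero mean in the `i`-th one. -/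
def oscPrim (i : Fin d) : ℕ → TorusFn d →ₗ[ℝ] TorusFn d
  | 0 => partialMean d i - partialMean d (i + 1)
  | k + 1 => coordPrim i ∘ₗ oscPrim i k

lemma coordMean_oscPrim (i : Fin d) (k : ℕ) (f : TorusFn d) : coordMean i (oscPrim i k f) = 0 := by
  cases k with
  | zero => simp [oscPrim, partialMean_succ, coordMean_coordMean]
  | succ k => exact coordMean_coordPrim i _

lemma pderiv_oscPrim (i : Fin d) (k : ℕ) (f : TorusFn d) :
    pderiv i (oscPrim i (k + 1) f) = oscPrim i k f := by
  rw [oscPrim, LinearMap.comp_apply, pderiv_coordPrim, coordMean_oscPrim, sub_zero]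

lemma sobNm_oscPrim_le {s : ℝ≥0∞} (hs : 1 ≤ s) (i : Fin d) (k m : ℕ) (f : TorusFn d) :
    sobNm s m (oscPrim i k f) ≤ 2 * sobNm s m f := by
  induction k with
  | zero =>
    refine (sobNm_sub_le hs m _ _).trans ?_
    have h1 := sobNm_partialMean_le hs i m f
    have h2 := sobNm_partialMean_le hs (i + 1) m f
    linarith
  | succ k ih => exact (sobNm_coordPrim_le hs i m _).trans ih

lemma oscPrim_dilate {n : ℕ} (hn : n ≠ 0) (i : Fin d) (k : ℕ) (f : TorusFn d) :
    oscPrim i k (dilate n f) = ((n : ℝ) ^ k)⁻¹ • dilate n (oscPrim i k f) := by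
  induction k with
  | zero => simp [oscPrim, partialMean_dilate hn]
  | succ k ih =>
    rw [oscPrim, LinearMap.comp_apply, ih, map_smul, coordPrim_dilate hn, smul_smul,
      LinearMap.comp_apply, pow_succ, mul_inv]

lemma sum_oscPrim (f : TorusFn d) : ∑ i : Fin d, oscPrim i 0 f = f - partialMean d d f := by
  change ∑ i : Fin d, (partialMean d i f - partialMean d (i + 1) f) = _
  rw [Fin.sum_univ_eq_sum_range fun n => partialMean d n f - partialMean d (n + 1) f,
    Finset.sum_range_sub' fun n => partialMean d n f]
  rfl

/-- The bilinear map `(f, g) ↦ ∂_i^k f · H_{i,l} g`, where `H_{i,l}` is `oscPrim i l`. -/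
def derivMulPrim (i : Fin d) (k l : ℕ) : TorusFn d →ₗ[ℝ] TorusFn d →ₗ[ℝ] TorusFn d :=
  (LinearMap.mul ℝ (TorusFn d)).compl₁₂ (pderiv i ^ k) (oscPrim i l)

lemma derivMulPrim_apply (i : Fin d) (k l : ℕ) (f g : TorusFn d) :
    derivMulPrim i k l f g = (pderiv i ^ k) f * oscPrim i l g := rfl

lemma pderiv_derivMulPrim (i : Fin d) (k l : ℕ) (f g : TorusFn d) :
    pderiv i (derivMulPrim i k (l + 1) f g)
      = derivMulPrim i (k + 1) (l + 1) f g + derivMulPrim i k l f g := by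
  simp only [derivMulPrim_apply, pderiv_mul, pderiv_oscPrim, pow_succ', Module.End.mul_apply]

/-- The main part of the antidivergence in the direction `i`. -/
def mainPart (i : Fin d) (N : ℕ) : TorusFn d →ₗ[ℝ] TorusFn d →ₗ[ℝ] TorusFn d :=
  ∑ k ∈ Finset.range N, ((-1 : ℝ) ^ k * (k + 1)) • derivMulPrim i k (k + 2)

/-- The error committed by the main part of the antidivergence in the direction `i`. -/
def errPart (i : Fin d) (N : ℕ) : TorusFn d →ₗ[ℝ] TorusFn d →ₗ[ℝ] TorusFn d :=
  ((-1 : ℝ) ^ N * (N + 1)) • derivMulPrim i N N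
    + ((-1 : ℝ) ^ N * N) • derivMulPrim i (N + 1) (N + 1)

lemma pderiv_pderiv_mainPart (i : Fin d) (N : ℕ) (f g : TorusFn d) :
    pderiv i (pderiv i (mainPart i N f g)) + errPart i N f g = f * oscPrim i 0 g := by
  induction N with
  | zero => simp [mainPart, errPart, derivMulPrim_apply]
  | succ N ih =>
    rw [← ih]
    have h : mainPart i (N + 1) f g
        = mainPart i N f g + ((-1 : ℝ) ^ N * (N + 1)) • derivMulPrim i N (N + 2) f g := by
      simp [mainPart, Finset.sum_range_succ]
    rw [h]
    simp only [map_add, map_smul, pderiv_derivMulPrim, errPart, LinearMap.add_apply,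
      LinearMap.smul_apply, pow_succ]
    push_cast
    module

/-- The total error `∑_i errPart i N`. -/
def totalErr (d N : ℕ) : TorusFn d →ₗ[ℝ] TorusFn d →ₗ[ℝ] TorusFn d := ∑ i, errPart i N

/-- The `i`-th diagonal entry of the double antidivergence. -/
def diagEntry (N : ℕ) (i : Fin d) : TorusFn d →ₗ[ℝ] TorusFn d →ₗ[ℝ] TorusFn d :=
  (mainPart i N).compr₂ (LinearMap.id - partialMean d d) + (totalErr d N).compr₂ (oscPrim i 2)

lemma diagEntry_apply (N : ℕ) (i : Fin d) (f g : TorusFn d) :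
    diagEntry N i f g = mainPart i N f g - partialMean d d (mainPart i N f g)
      + oscPrim i 2 (totalErr d N f g) := by
  simp [diagEntry]

lemma integral_diagEntry (N : ℕ) (i : Fin d) (f g : TorusFn d) :
    ∫ x, (diagEntry N i f g).1 x ∂μbox d = 0 := by
  set u := mainPart i N f g
  have h1 : (diagEntry N i f g).1
      = u.1 - (partialMean d d u).1 + (oscPrim i 2 (totalErr d N f g)).1 := by
    rw [diagEntry_apply]
    rfl
  rw [h1, integral_add' (u.integrable.sub (partialMean d d u).integrable) (TorusFn.integrable _),
    integral_sub' u.integrable (TorusFn.integrable _), integral_partialMean,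
    integral_eq_zero_of_coordMean_eq_zero (coordMean_oscPrim i 2 _)]
  simp

lemma sum_pderiv_pderiv_diagEntry (N : ℕ) {f g : TorusFn d} (hg : ∫ x, g.1 x ∂μbox d = 0) :
    ∑ i, pderiv i (pderiv i (diagEntry N i f g)) = f * g - partialMean d d (f * g) := by
  have hPg : partialMean d d g = 0 := by
    ext x
    rw [partialMean_apply, hg]
    rfl
  have e0 : ∑ i, pderiv i (pderiv i (mainPart i N f g)) + totalErr d N f g = f * g := by
    simp only [totalErr, LinearMap.sum_apply]
    rw [← Finset.sum_add_distrib]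
    simp only [pderiv_pderiv_mainPart]
    rw [← Finset.mul_sum, sum_oscPrim, hPg, sub_zero]
  have hPd : ∀ i (u : TorusFn d), partialMean d d (pderiv i u) = 0 := fun i u => by
    ext x
    rw [partialMean_apply, integral_pderiv]
    rfl
  have e1 : partialMean d d (totalErr d N f g) = partialMean d d (f * g) := by
    rw [← e0, map_add, map_sum]
    simp [hPd]
  have e2 : ∀ i, pderiv i (pderiv i (diagEntry N i f g))
      = pderiv i (pderiv i (mainPart i N f g)) + oscPrim i 0 (totalErr d N f g) := fun i => by
    rw [diagEntry_apply]
    simp [pderiv_oscPrim, pderiv_partialMean_eq_zero]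
  simp only [e2]
  rw [Finset.sum_add_distrib, sum_oscPrim, e1, ← e0]
  abel

end construction

section estimate

variable {d : ℕ}

lemma sobNm_derivMulPrim_le {p r s : ℝ≥0∞} (hp : 1 ≤ p) (hs : 1 ≤ s) (h : 1 / p = 1 / s + 1 / r)
    (i : Fin d) (k l j : ℕ) {n : ℕ} (hn : n ≠ 0) {E W : ℝ} (hE : 0 ≤ E) (hW : 0 ≤ W)
    (f g : TorusFn d) (hf : ∀ a ≤ j, sobNm r (a + k) f ≤ E * (n : ℝ) ^ (a + l))
    (hg : ∀ b ≤ j, sobNm s b g ≤ W) :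
    sobNm p j (derivMulPrim i k l f (dilate n g)) ≤ (2 * d) ^ j * (2 * E * W * (n : ℝ) ^ j) := by
  have hn' : (0 : ℝ) < n := by exact_mod_cast Nat.pos_of_ne_zero hn
  rw [derivMulPrim_apply, oscPrim_dilate hn]
  refine (sobNm_mul_le hp h (c := n) (F := E * n ^ l) (G := 2 * W * ((n : ℝ) ^ l)⁻¹)
    (by positivity) (by positivity) hn'.le j _ _ (fun a ha => ?_) (fun b hb => ?_)).trans_eq ?_
  · rw [Module.End.pow_apply]
    exact (sobNm_iterate_pderiv_le r i k a f).trans ((hf a ha).trans_eq (by ring))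
  · rw [sobNm_smul, sobNm_dilate s hn, abs_of_nonneg (by positivity)]
    calc ((n : ℝ) ^ l)⁻¹ * (n ^ b * sobNm s b (oscPrim i l g))
        ≤ ((n : ℝ) ^ l)⁻¹ * (n ^ b * (2 * W)) := by
          gcongr
          exact (sobNm_oscPrim_le hs i l b g).trans (by linarith [hg b hb])
      _ = _ := by ring
  · field_simp

lemma exists_sobNm_diagEntry_le (d N : ℕ) (hN : 1 ≤ N) (j : ℕ) : ∃ C : ℝ, 0 ≤ C ∧
    ∀ (p r s : ℝ≥0∞) (_ : 1 ≤ p) (_ : 1 ≤ r) (_ : 1 ≤ s) (_ : 1 / p = 1 / s + 1 / r)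
      (i : Fin d) (f g : TorusFn d) (n : ℕ) (_ : 1 ≤ n) (W Φ : ℝ)
      (_ : ∀ b ≤ j, sobNm s b g ≤ W)
      (_ : Φ = ((n : ℝ) ^ 2)⁻¹ * sobNm r 0 f + ((n : ℝ) ^ N)⁻¹ * sobNm r N f
        + ((n : ℝ) ^ (2 * N + j))⁻¹ * sobNm r (2 * N + j) f),
      sobNm p j (diagEntry N i f (dilate n g)) ≤ C * (n : ℝ) ^ j * W * Φ := by
  obtain ⟨C, hC, hCb⟩ := exists_sobNm_le d N (2 * N + j) (by omega)
  refine ⟨(2 * (∑ k ∈ Finset.range N, ((k : ℝ) + 1)) + 2 * (d * (2 * N + 1))) *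
    ((2 * d) ^ j * (2 * C)), by positivity, ?_⟩
  intro p r s hp hr hs h i f g n hn W Φ hW hΦ
  have hn' : (1 : ℝ) ≤ n := by exact_mod_cast hn
  have hn0 : n ≠ 0 := by omega
  obtain ⟨hb1, hb2⟩ := hCb r hr n hn' f Φ hΦ
  have hW0 : 0 ≤ W := (sobNm_nonneg s 0 g).trans (hW 0 (Nat.zero_le _))
  have hΦ0 : 0 ≤ Φ := by
    have := sobNm_nonneg r 0 f
    have := sobNm_nonneg r N f
    have := sobNm_nonneg r (2 * N + j) f
    rw [hΦ]
    positivity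
  set T : ℝ := (2 * d) ^ j * (2 * (C * Φ) * W * (n : ℝ) ^ j) with hT
  have hT0 : 0 ≤ T := by positivity
  have ha : ∀ k : ℕ, |(-1 : ℝ) ^ k| = 1 := fun k => by simp
  have hmain : ∀ i, sobNm p j (mainPart i N f (dilate n g))
      ≤ (∑ k ∈ Finset.range N, ((k : ℝ) + 1)) * T := fun i => by
    simp only [mainPart, LinearMap.sum_apply, LinearMap.smul_apply]
    refine (sobNm_sum_le hp j _ _).trans ?_
    rw [Finset.sum_mul]
    refine Finset.sum_le_sum fun k hk => ?_
    have hk := Finset.mem_range.1 hk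
    rw [sobNm_smul, abs_mul, ha, one_mul, abs_of_nonneg (by positivity)]
    gcongr
    exact sobNm_derivMulPrim_le hp hs h i k (k + 2) j hn0 (by positivity) hW0 f g
      (fun a ha => (hb1 (a + k) (by omega)).trans_eq (by ring)) hW
  have herr : ∀ i, sobNm p j (errPart i N f (dilate n g)) ≤ (2 * N + 1) * T := fun i => by
    have key : ∀ k, N ≤ k → k ≤ N + 1 → sobNm p j (derivMulPrim i k k f (dilate n g)) ≤ T :=
      fun k h1 h2 => sobNm_derivMulPrim_le hp hs h i k k j hn0 (by positivity) hW0 f g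
        (fun a ha => hb2 (a + k) (by omega) (by omega)) hW
    simp only [errPart, LinearMap.add_apply, LinearMap.smul_apply]
    refine (sobNm_add_le hp j _ _).trans ?_
    rw [sobNm_smul, sobNm_smul, abs_mul, abs_mul, ha, one_mul, one_mul,
      abs_of_nonneg (by positivity), abs_of_nonneg (by positivity)]
    have k1 := mul_le_mul_of_nonneg_left (key N le_rfl (by omega)) (a := (N : ℝ) + 1)
      (by positivity)
    have k2 := mul_le_mul_of_nonneg_left (key (N + 1) (by omega) le_rfl) (a := (N : ℝ))
      (by positivity)
    linarith
  have htot : sobNm p j (totalErr d N f (dilate n g)) ≤ d * (2 * N + 1) * T := by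
    simp only [totalErr, LinearMap.sum_apply]
    refine (sobNm_sum_le hp j _ _).trans ((Finset.sum_le_sum fun i _ => herr i).trans_eq ?_)
    simp
    ring
  rw [diagEntry_apply]
  refine (sobNm_add_le hp j _ _).trans ((add_le_add (sobNm_sub_le hp j _ _)
    (sobNm_oscPrim_le hp i 2 j _)).trans ?_)
  have h3 := sobNm_partialMean_le hp d j (mainPart i N f (dilate n g))
  have h4 := hmain i
  calc _ ≤ (2 * (∑ k ∈ Finset.range N, ((k : ℝ) + 1)) + 2 * (d * (2 * N + 1))) * T := by linarith
    _ = _ := by rw [hT]; ring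

end estimate

section comparison

variable {d : ℕ}

lemma TorusFn.continuous_iteratedFDeriv (f : TorusFn d) (m : ℕ) :
    Continuous (iteratedFDeriv ℝ m f.1) :=
  f.contDiff.continuous_iteratedFDeriv (by exact_mod_cast le_top)

lemma eLpNorm_iteratedFDeriv_ne_top (s : ℝ≥0∞) (m : ℕ) (f : TorusFn d) :
    eLpNorm (fun x => iteratedFDeriv ℝ m f.1 x) s (μbox d) ≠ ∞ := by
  rw [← eLpNorm_norm]
  exact (memLp_of_continuous (f.continuous_iteratedFDeriv m).norm s).2.ne

lemma norm_basisVec_le (i : Fin d) : ‖basisVec i‖ ≤ 1 := by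
  simp [basisVec, Pi.norm_single]

lemma eLpNorm_iteratedFDeriv_pderiv_le (s : ℝ≥0∞) (i : Fin d) (m : ℕ) (f : TorusFn d) :
    eLpNorm (fun x => iteratedFDeriv ℝ m (pderiv i f).1 x) s (μbox d)
      ≤ eLpNorm (fun x => iteratedFDeriv ℝ (m + 1) f.1 x) s (μbox d) := by
  refine eLpNorm_mono fun x => ?_
  have hc : ContDiff ℝ ((⊤ : ℕ∞)) (fderiv ℝ f.1) := f.contDiff.fderiv_right (by simp)
  refine (norm_iteratedFDeriv_clm_apply_const (c := basisVec i) (N := ((⊤ : ℕ∞)))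
    hc.contDiffAt (by exact_mod_cast le_top)).trans ?_
  rw [norm_iteratedFDeriv_fderiv]
  exact mul_le_of_le_one_left (norm_nonneg _) (norm_basisVec_le i)

lemma sobNm_le_eLpNorm_iteratedFDeriv (s : ℝ≥0∞) (m : ℕ) (f : TorusFn d) :
    sobNm s m f
      ≤ d ^ m * (eLpNorm (fun x => iteratedFDeriv ℝ m f.1 x) s (μbox d)).toReal := by
  induction m generalizing f with
  | zero =>
    rw [pow_zero, one_mul]
    refine ENNReal.toReal_mono (eLpNorm_iteratedFDeriv_ne_top s 0 f) (eLpNorm_mono fun x => ?_)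
    rw [norm_iteratedFDeriv_zero]
  | succ m ih =>
    have h : ∀ i, sobNm s m (pderiv i f) ≤ d ^ m *
        (eLpNorm (fun x => iteratedFDeriv ℝ (m + 1) f.1 x) s (μbox d)).toReal := fun i => by
      refine (ih _).trans ?_
      gcongr
      exacts [eLpNorm_iteratedFDeriv_ne_top s _ f, eLpNorm_iteratedFDeriv_pderiv_le s i m f]
    refine (Finset.sum_le_sum fun i _ => h i).trans_eq ?_
    simp
    ring

lemma eLpNorm_iteratedFDeriv_sum_smul_le {E : Type} [NormedAddCommGroup E] [NormedSpace ℝ E]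
    {s : ℝ≥0∞} (hs : 1 ≤ s) (m : ℕ) (f : Fin d → TorusFn d) (e : Fin d → E)
    (he : ∀ i, ‖e i‖ ≤ 1) :
    eLpNorm (fun x => iteratedFDeriv ℝ m (fun y => ∑ i, (f i).1 y • e i) x) s (μbox d)
      ≤ ∑ i, eLpNorm (fun x => iteratedFDeriv ℝ m (f i).1 x) s (μbox d) := by
  have hcd : ∀ i, ContDiff ℝ m (f i).1 := fun i =>
    (f i).contDiff.of_le (by exact_mod_cast le_top)
  have h1 : ∀ x, ‖iteratedFDeriv ℝ m (fun y => ∑ i, (f i).1 y • e i) x‖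
      ≤ ∑ i, ‖iteratedFDeriv ℝ m (f i).1 x‖ := fun x => by
    rw [iteratedFDeriv_fun_sum_apply (f := fun i y => (f i).1 y • e i)
      fun i _ => ((hcd i).smul contDiff_const).contDiffAt]
    refine (norm_sum_le _ _).trans (Finset.sum_le_sum fun i _ => ?_)
    have h2 := ContinuousLinearMap.norm_iteratedFDeriv_comp_left
      (ContinuousLinearMap.toSpanSingleton ℝ (e i)) (x := x) (n := m) (hcd i).contDiffAt le_rfl
    refine h2.trans (mul_le_of_le_one_left (norm_nonneg _) ?_)
    rw [ContinuousLinearMap.norm_toSpanSingleton]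
    exact he i
  refine (eLpNorm_mono_real h1).trans ?_
  have h3 := eLpNorm_sum_le (p := s) (μ := μbox d) (s := Finset.univ)
    (f := fun i x => ‖iteratedFDeriv ℝ m (f i).1 x‖)
    (fun i _ => ((f i).continuous_iteratedFDeriv m).norm.aestronglyMeasurable) hs
  simp only [eLpNorm_norm] at h3
  rwa [Finset.sum_fn] at h3

lemma eLpNorm_iteratedFDeriv_le {s : ℝ≥0∞} (hs : 1 ≤ s) (m : ℕ) (f : TorusFn d) :
    eLpNorm (fun x => iteratedFDeriv ℝ m f.1 x) s (μbox d) ≤ ENNReal.ofReal (sobNm s m f) := by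
  induction m generalizing f with
  | zero =>
    rw [sobNm, ofReal_lpNm]
    refine eLpNorm_mono fun x => ?_
    rw [norm_iteratedFDeriv_zero]
  | succ m ih =>
    rw [sobNm, ENNReal.ofReal_sum_of_nonneg fun i _ => sobNm_nonneg s m _]
    calc _ = eLpNorm (fun x => iteratedFDeriv ℝ m (fderiv ℝ f.1) x) s (μbox d) :=
          eLpNorm_congr_norm_ae (Filter.Eventually.of_forall fun x =>
            norm_iteratedFDeriv_fderiv.symm)
      _ = eLpNorm (fun x => iteratedFDeriv ℝ m (fun y => ∑ i, (pderiv i f).1 y •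
            ContinuousLinearMap.proj (R := ℝ) (φ := fun _ : Fin d => ℝ) i) x) s (μbox d) := by
          rw [show fderiv ℝ f.1 = fun y => ∑ i, (pderiv i f).1 y •
            ContinuousLinearMap.proj (R := ℝ) (φ := fun _ : Fin d => ℝ) i
            from funext (fderiv_eq_sum f)]
      _ ≤ _ := eLpNorm_iteratedFDeriv_sum_smul_le hs m _ _ fun i =>
          ContinuousLinearMap.opNorm_le_bound _ zero_le_one fun y => by
            rw [one_mul]
            exact norm_le_pi_norm y i
      _ ≤ _ := Finset.sum_le_sum fun i _ => ih _

lemma WNorm_ne_top (j : ℕ) (s : ℝ≥0∞) (g : TorusFn d) : WNorm d j s g.1 ≠ ∞ :=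
  ENNReal.sum_ne_top.2 fun m _ => eLpNorm_iteratedFDeriv_ne_top s m g

lemma sobNm_le_WNorm (hd : 1 ≤ d) {j b : ℕ} (hb : b ≤ j) (s : ℝ≥0∞) (g : TorusFn d) :
    sobNm s b g ≤ d ^ j * (WNorm d j s g.1).toReal := by
  refine (sobNm_le_eLpNorm_iteratedFDeriv s b g).trans ?_
  have hd' : (1 : ℝ) ≤ d := by exact_mod_cast hd
  have h : eLpNorm (fun x => iteratedFDeriv ℝ b g.1 x) s (μbox d) ≤ WNorm d j s g.1 :=
    Finset.single_le_sum (f := fun m => eLpNorm (fun x => iteratedFDeriv ℝ m g.1 x) s (μbox d))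
      (fun _ _ => zero_le) (Finset.mem_range.2 (by omega))
  gcongr
  exacts [WNorm_ne_top j s g]

end comparison

section operator

variable {d : ℕ}

/-- The diagonal matrix units. -/
def diagUnit (i : Fin d) : Mat d := Pi.single i (Pi.single i 1)

lemma norm_diagUnit_le (i : Fin d) : ‖diagUnit i‖ ≤ 1 := by
  simp [diagUnit, Pi.norm_single]

lemma sum_smul_diagUnit_apply (c : Fin d → ℝ) (a b : Fin d) :
    (∑ i, c i • diagUnit i) a b = if a = b then c a else 0 := by
  simp only [Finset.sum_apply, Pi.smul_apply, diagUnit, Pi.single_apply, smul_eq_mul]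
  rw [Finset.sum_eq_single a (fun i _ hi => by simp [hi.symm]) (by simp)]
  simp [Pi.single_apply, eq_comm]

open Classical in
/-- The double antidivergence operator `R²_N`, extended by zero to non-smooth arguments. -/
def doubleAntidiv (d N : ℕ) (f g : Pt d → ℝ) : Pt d → Mat d :=
  if h : AdmissibleScal d f ∧ AdmissibleScal d g then
    fun x => ∑ i, (diagEntry N i (⟨f, h.1⟩ : TorusFn d) ⟨g, h.2⟩).1 x • diagUnit i
  else 0

lemma doubleAntidiv_coe (N : ℕ) (f g : TorusFn d) :
    doubleAntidiv d N f.1 g.1 = fun x => ∑ i, (diagEntry N i f g).1 x • diagUnit i :=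
  dif_pos ⟨f.2, g.2⟩

lemma doubleAntidiv_apply (N : ℕ) (f g : TorusFn d) (x : Pt d) (a b : Fin d) :
    doubleAntidiv d N f.1 g.1 x a b = if a = b then (diagEntry N a f g).1 x else 0 := by
  rw [doubleAntidiv_coe]
  exact sum_smul_diagUnit_apply (fun i => (diagEntry N i f g).1 x) a b

lemma divDivMat_doubleAntidiv (N : ℕ) (f g : TorusFn d) (hg : ∫ x, g.1 x ∂μbox d = 0) (x : Pt d) :
    divDivMat (doubleAntidiv d N f.1 g.1) x = f.1 x * g.1 x - ∫ y, f.1 y * g.1 y ∂μbox d := by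
  have h1 : ∀ i j, fderiv ℝ (fun y => fderiv ℝ (fun z => doubleAntidiv d N f.1 g.1 z i j) y
      (Pi.single j 1)) x (Pi.single i 1)
      = if i = j then (pderiv i (pderiv i (diagEntry N i f g))).1 x else 0 := by
    intro i j
    simp only [doubleAntidiv_apply]
    split_ifs with h
    · subst h
      rfl
    · simp
  simp only [divDivMat, h1, Finset.sum_ite_eq, Finset.mem_univ, if_true]
  have h2 := congrArg (fun u : TorusFn d => u.1 x) (sum_pderiv_pderiv_diagEntry N (f := f) hg)
  simp only [Subalgebra.coe_sub, Pi.sub_apply, partialMean_apply, Subalgebra.coe_mul,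
    Pi.mul_apply, AddSubmonoidClass.coe_finsetSum, Finset.sum_apply] at h2
  exact h2

lemma ofReal_inv_pow {n : ℕ} (hn : 1 ≤ n) (k : ℕ) {y : ℝ} (hy : y = k) :
    ENNReal.ofReal (((n : ℝ) ^ k)⁻¹) = (n : ℝ≥0∞) ^ (-y) := by
  have hn' : (0 : ℝ) < n := by exact_mod_cast hn
  rw [ENNReal.ofReal_inv_of_pos (by positivity), ENNReal.ofReal_pow hn'.le, ENNReal.rpow_neg, hy,
    ENNReal.rpow_natCast, ENNReal.ofReal_natCast]

lemma ofReal_sobNm_le (hd : 1 ≤ d) (r : ℝ≥0∞) {m M : ℕ} (hm : m ≤ M) (f : TorusFn d) :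
    ENNReal.ofReal (sobNm r m f)
      ≤ (d : ℝ≥0∞) ^ M * eLpNorm (fun x => iteratedFDeriv ℝ m f.1 x) r (μbox d) := by
  have hd' : (1 : ℝ≥0∞) ≤ d := by exact_mod_cast hd
  refine (ENNReal.ofReal_le_ofReal (sobNm_le_eLpNorm_iteratedFDeriv r m f)).trans ?_
  rw [ENNReal.ofReal_mul (by positivity), ENNReal.ofReal_toReal
    (eLpNorm_iteratedFDeriv_ne_top r m f), ENNReal.ofReal_pow (by positivity),
    ENNReal.ofReal_natCast]
  gcongr

lemma exists_eLpNorm_doubleAntidiv_le (hd : 1 ≤ d) {N : ℕ} (hN : 1 ≤ N) (j : ℕ) : ∃ C : ℝ≥0,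
    ∀ (p r s : ℝ≥0∞) (_ : 1 ≤ p) (_ : 1 ≤ r) (_ : 1 ≤ s) (_ : 1 / p = 1 / s + 1 / r)
      (f g : TorusFn d) (n : ℕ) (_ : 1 ≤ n),
      eLpNorm (fun x => iteratedFDeriv ℝ j (doubleAntidiv d N f.1 (dilate n g).1) x) p (μbox d)
        ≤ C * (n : ℝ≥0∞) ^ (j : ℝ) * WNorm d j s g.1 *
          ((n : ℝ≥0∞) ^ (-(2 : ℝ)) * eLpNorm f.1 r (μbox d)
            + (n : ℝ≥0∞) ^ (-(N : ℝ)) * eLpNorm (fun x => iteratedFDeriv ℝ N f.1 x) r (μbox d)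
            + (n : ℝ≥0∞) ^ (-(2 * (N : ℝ) + (j : ℝ)))
              * eLpNorm (fun x => iteratedFDeriv ℝ (2 * N + j) f.1 x) r (μbox d)) := by
  obtain ⟨C, hC, hCb⟩ := exists_sobNm_diagEntry_le d N hN j
  refine ⟨d * C.toNNReal * d ^ j * d ^ (2 * N + j), fun p r s hp hr hs h f g n hn => ?_⟩
  set M := 2 * N + j with hM
  have hn' : (0 : ℝ) < n := by exact_mod_cast hn
  set W := WNorm d j s g.1 with hW
  set Ψ : ℝ≥0∞ := (n : ℝ≥0∞) ^ (-(2 : ℝ)) * eLpNorm f.1 r (μbox d)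
    + (n : ℝ≥0∞) ^ (-(N : ℝ)) * eLpNorm (fun x => iteratedFDeriv ℝ N f.1 x) r (μbox d)
    + (n : ℝ≥0∞) ^ (-(2 * (N : ℝ) + (j : ℝ)))
      * eLpNorm (fun x => iteratedFDeriv ℝ M f.1 x) r (μbox d) with hΨ
  set Φ : ℝ := ((n : ℝ) ^ 2)⁻¹ * sobNm r 0 f + ((n : ℝ) ^ N)⁻¹ * sobNm r N f
    + ((n : ℝ) ^ M)⁻¹ * sobNm r M f with hΦ
  have hΦΨ : ENNReal.ofReal Φ ≤ (d : ℝ≥0∞) ^ M * Ψ := by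
    have h0 := sobNm_nonneg r 0 f
    have h1 := sobNm_nonneg r N f
    have h2 := sobNm_nonneg r M f
    rw [hΦ, ENNReal.ofReal_add (by positivity) (by positivity),
      ENNReal.ofReal_add (by positivity) (by positivity), ENNReal.ofReal_mul (by positivity),
      ENNReal.ofReal_mul (by positivity), ENNReal.ofReal_mul (by positivity),
      ofReal_inv_pow hn 2 (y := 2) (by norm_num), ofReal_inv_pow hn N rfl,
      ofReal_inv_pow hn M (y := 2 * (N : ℝ) + j) (by rw [hM]; push_cast; ring), hΨ,
      mul_add, mul_add]
    have e0 : eLpNorm (fun x => iteratedFDeriv ℝ 0 f.1 x) r (μbox d) = eLpNorm f.1 r (μbox d) :=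
      eLpNorm_congr_norm_ae (Filter.Eventually.of_forall fun x => norm_iteratedFDeriv_zero)
    have k0 := ofReal_sobNm_le hd r (Nat.zero_le M) f
    rw [e0] at k0
    have k1 := ofReal_sobNm_le hd r (show N ≤ M by omega) f
    have k2 := ofReal_sobNm_le hd r (le_refl M) f
    simp only [mul_left_comm ((d : ℝ≥0∞) ^ M)]
    gcongr
  have hent : ∀ i, ENNReal.ofReal (sobNm p j (diagEntry N i f (dilate n g)))
      ≤ ENNReal.ofReal C * (n : ℝ≥0∞) ^ (j : ℝ) * ((d : ℝ≥0∞) ^ j * W)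
        * ((d : ℝ≥0∞) ^ M * Ψ) := fun i => by
    refine (ENNReal.ofReal_le_ofReal (hCb p r s hp hr hs h i f g n hn (d ^ j * W.toReal) Φ
      (fun b hb => sobNm_le_WNorm hd hb s g) hΦ)).trans ?_
    rw [ENNReal.ofReal_mul (by positivity), ENNReal.ofReal_mul (by positivity),
      ENNReal.ofReal_mul (by positivity), ENNReal.ofReal_mul (by positivity),
      ENNReal.ofReal_pow hn'.le, ENNReal.ofReal_pow (by positivity), ENNReal.ofReal_natCast,
      ENNReal.ofReal_natCast, ENNReal.ofReal_toReal (WNorm_ne_top j s g), ENNReal.rpow_natCast]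
    gcongr
  rw [doubleAntidiv_coe]
  calc _ ≤ ∑ i,
          eLpNorm (fun x => iteratedFDeriv ℝ j (diagEntry N i f (dilate n g)).1 x) p (μbox d) :=
        eLpNorm_iteratedFDeriv_sum_smul_le hp j _ _ norm_diagUnit_le
    _ ≤ ∑ _i : Fin d, ENNReal.ofReal C * (n : ℝ≥0∞) ^ (j : ℝ) * ((d : ℝ≥0∞) ^ j * W)
        * ((d : ℝ≥0∞) ^ M * Ψ) :=
      Finset.sum_le_sum fun i _ => (eLpNorm_iteratedFDeriv_le hp j _).trans (hent i)
    _ = _ := by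
      simp only [Finset.sum_const, Finset.card_univ, Fintype.card_fin, nsmul_eq_mul,
        ENNReal.ofReal]
      push_cast
      ring

end operator

/-- **Improved symmetric bilinear double antidivergence `R²_N`**
(Proposition 3.5 (iv)): for every `N ≥ 1` there is a bilinear operator taking a
smooth function `f` and a smooth zero-mean function `g` to a smooth zero-mean
symmetric-matrix field with `div div R²_N(f,g) = fg - ⨍ fg` and
`|∇^j R²_N(f, g(λ·))|_p ≤ C λ^j |g|_{W^{j,s}} (λ^{-2}|f|_r + λ^{-N}|∇^N f|_r +
λ^{-(2N+j)}|∇^{2N+j} f|_r)` whenever `1/p = 1/s + 1/r`. -/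
theorem improved_bilinear_double_antidivergence (d : ℕ) (hd : 1 ≤ d) (N : ℕ) (hN : 1 ≤ N) :
    ∃ R : (Pt d → ℝ) → (Pt d → ℝ) → (Pt d → Mat d),
      -- mapping properties
      (∀ f g, AdmissibleScal d f → AdmissibleScal₀ d g →
        ContDiff ℝ ((⊤:ℕ∞)) (R f g) ∧ ZPer (R f g) ∧
        (∀ i j, (∫ x in box d, R f g x i j) = 0) ∧
        (∀ x i j, R f g x i j = R f g x j i) ∧
        (∀ x, divDivMat (R f g) x = f x * g x - ∫ y in box d, f y * g y)) ∧
      -- bilinearity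
      (∀ f f' g, AdmissibleScal d f → AdmissibleScal d f' → AdmissibleScal₀ d g →
        R (f + f') g = R f g + R f' g) ∧
      (∀ (c : ℝ) f g, AdmissibleScal d f → AdmissibleScal₀ d g →
        R (c • f) g = c • R f g) ∧
      (∀ f g g', AdmissibleScal d f → AdmissibleScal₀ d g → AdmissibleScal₀ d g' →
        R f (g + g') = R f g + R f g') ∧
      (∀ (c : ℝ) f g, AdmissibleScal d f → AdmissibleScal₀ d g →
        R f (c • g) = c • R f g) ∧
      -- the oscillation estimate
      (∀ (j : ℕ) (p r s : ℝ≥0∞), 1 ≤ p → 1 ≤ r → 1 ≤ s → 1 / p = 1 / s + 1 / r →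
        ∃ C : ℝ≥0, ∀ f g, AdmissibleScal d f → AdmissibleScal₀ d g →
          ∀ lam : ℕ, 1 ≤ lam →
            eLpNorm (fun x => iteratedFDeriv ℝ j
                (R f (fun y => g (fun i => (lam : ℝ) * y i))) x) p (μbox d)
              ≤ C * (lam : ℝ≥0∞) ^ (j : ℝ) * WNorm d j s g *
                  ((lam : ℝ≥0∞) ^ (-(2 : ℝ)) * eLpNorm f r (μbox d)
                    + (lam : ℝ≥0∞) ^ (-(N : ℝ))
                      * eLpNorm (fun x => iteratedFDeriv ℝ N f x) r (μbox d)
                    + (lam : ℝ≥0∞) ^ (-(2 * (N : ℝ) + (j : ℝ)))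
                      * eLpNorm (fun x => iteratedFDeriv ℝ (2 * N + j) f x) r (μbox d))) := by
  refine ⟨doubleAntidiv d N, fun f g hf hg => ?_, fun f f' g hf hf' hg => ?_,
    fun c f g hf hg => ?_, fun f g g' hf hg hg' => ?_, fun c f g hf hg => ?_,
    fun j p r s hp hr hs h => ?_⟩
  · lift f to TorusFn d using hf
    obtain ⟨hg, hg0⟩ := hg
    lift g to TorusFn d using hg
    refine ⟨?_, ?_, fun i j => ?_, fun x i j => ?_, divDivMat_doubleAntidiv N f g hg0⟩
    · rw [doubleAntidiv_coe]
      exact ContDiff.sum fun i _ => (TorusFn.contDiff _).smul contDiff_const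
    · intro x m
      rw [doubleAntidiv_coe]
      exact Finset.sum_congr rfl fun i _ =>
        congrArg (· • diagUnit i) ((diagEntry N i f g).zPer x m)
    · simp only [doubleAntidiv_apply]
      split_ifs
      · exact integral_diagEntry N i f g
      · simp
    · rw [doubleAntidiv_apply, doubleAntidiv_apply]
      by_cases hij : i = j
      · rw [hij]
      · rw [if_neg hij, if_neg (Ne.symm hij)]
  · have e := doubleAntidiv_coe N ((⟨f, hf⟩ : TorusFn d) + ⟨f', hf'⟩) ⟨g, hg.1⟩
    refine e.trans ?_
    rw [doubleAntidiv_coe N (⟨f, hf⟩ : TorusFn d) ⟨g, hg.1⟩,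
      doubleAntidiv_coe N (⟨f', hf'⟩ : TorusFn d) ⟨g, hg.1⟩]
    funext x
    simp [add_smul, Finset.sum_add_distrib]
  · have e := doubleAntidiv_coe N (c • (⟨f, hf⟩ : TorusFn d)) ⟨g, hg.1⟩
    refine e.trans ?_
    rw [doubleAntidiv_coe N (⟨f, hf⟩ : TorusFn d) ⟨g, hg.1⟩]
    funext x
    simp [mul_smul, Finset.smul_sum]
  · have e := doubleAntidiv_coe N (⟨f, hf⟩ : TorusFn d) (⟨g, hg.1⟩ + ⟨g', hg'.1⟩)
    refine e.trans ?_
    rw [doubleAntidiv_coe N (⟨f, hf⟩ : TorusFn d) ⟨g, hg.1⟩,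
      doubleAntidiv_coe N (⟨f, hf⟩ : TorusFn d) ⟨g', hg'.1⟩]
    funext x
    simp [add_smul, Finset.sum_add_distrib]
  · have e := doubleAntidiv_coe N (⟨f, hf⟩ : TorusFn d) (c • ⟨g, hg.1⟩)
    refine e.trans ?_
    rw [doubleAntidiv_coe N (⟨f, hf⟩ : TorusFn d) ⟨g, hg.1⟩]
    funext x
    simp [mul_smul, Finset.smul_sum]
  · obtain ⟨C, hC⟩ := exists_eLpNorm_doubleAntidiv_le hd hN j
    exact ⟨C, fun f g hf hg lam hlam => hC p r s hp hr hs h ⟨f, hf⟩ ⟨g, hg.1⟩ lam hlam⟩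

end NonNewtonian
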